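/- arXiv:1309.3342 — 4 statements merged into one kernel-verified Lean document; each statement's English description precedes it below -/
import Mathlib

section
/- For the coefficients 𝔟_i, 𝔠_i, 𝔡 obtained by linearizing the Euler–Poisson fluxes at the subsonic background solution: (c) for each i = 1, 2, the cancellation identity 𝔟_i(x) + 𝔠_i(x) = 0 holds for all x ∈ N (explicitly, 𝔟₁ = −𝔠₁ = ρ̄^{2−γ}ū/(γ𝔭 e^{S₀/c_v}) and 𝔟₂ = 𝔠₂ = 0); and (d) 𝔡(x) = ρ̄(x₁)^{2−γ}/(γ𝔭 e^{S₀/c_v}), and there exists a constant ν₂>0 depending only on the data such that 𝔡(x) ≥ ν₂ for all x ∈ N. -/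
open Real Set Metric MeasureTheory
open scoped ENNReal

noncomputable section

abbrev Pt : Type := ℝ × ℝ

/-- partial derivative in the `x₁` direction -/
def pd1 (f : Pt → ℝ) : Pt → ℝ := fun x => fderiv ℝ f x (1, 0)

/-- partial derivative in the `x₂` direction -/
def pd2 (f : Pt → ℝ) : Pt → ℝ := fun x => fderiv ℝ f x (0, 1)

/-- mixed partial derivative `∂₁^i ∂₂^j` -/
def Dmix (i j : ℕ) (f : Pt → ℝ) : Pt → ℝ := pd1^[i] (pd2^[j] f)

/-- Laplacian -/
def lap (f : Pt → ℝ) : Pt → ℝ := fun x => pd1 (pd1 f) x + pd2 (pd2 f) x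

/-- the nozzle `N = (0,L) × (0,1)` -/
def Noz (L : ℝ) : Set Pt := Ioo 0 L ×ˢ Ioo 0 1

/-- the entrance `Γ₀ = {0} × [0,1]` -/
def Gam0 : Set Pt := {0} ×ˢ Icc 0 1

/-- the exit `Γ_L = {L} × [0,1]` -/
def GamL (L : ℝ) : Set Pt := {L} ×ˢ Icc 0 1

/-- the insulated walls `Γ_w = (0,L) × {0,1}` -/
def GamW (L : ℝ) : Set Pt := Ioo 0 L ×ˢ ({0, 1} : Set ℝ)

/-- the closed walls `Γ̄_w = [0,L] × {0,1}` -/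
def GamWbar (L : ℝ) : Set Pt := Icc 0 L ×ˢ ({0, 1} : Set ℝ)

/-- `f` is `C^m` on an open neighborhood of `K` (encoding of "`C^m` up to the boundary") -/
def UpTo (m : ℕ) (f : Pt → ℝ) (K : Set Pt) : Prop :=
  ∃ U : Set Pt, IsOpen U ∧ K ⊆ U ∧ ContDiffOn ℝ m f U

/-! ### Hölder norms (ℝ≥0∞–valued) -/

def supAbs (Ω : Set Pt) (g : Pt → ℝ) : ℝ≥0∞ := ⨆ x ∈ Ω, ENNReal.ofReal |g x|

def hSemi (α : ℝ) (Ω : Set Pt) (g : Pt → ℝ) : ℝ≥0∞ :=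
  ⨆ x ∈ Ω, ⨆ y ∈ Ω, ⨆ _ : x ≠ y, ENNReal.ofReal (|g x - g y| / ‖x - y‖ ^ α)

def idxLe (m : ℕ) : Finset (ℕ × ℕ) :=
  (Finset.range (m+1) ×ˢ Finset.range (m+1)).filter (fun p => p.1 + p.2 ≤ m)

def idxEq (m : ℕ) : Finset (ℕ × ℕ) :=
  (Finset.range (m+1) ×ˢ Finset.range (m+1)).filter (fun p => p.1 + p.2 = m)

/-- the Hölder norm `‖f‖_{m,α,Ω}` -/
def hNorm (m : ℕ) (α : ℝ) (Ω : Set Pt) (f : Pt → ℝ) : ℝ≥0∞ :=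
  ∑ p ∈ idxLe m, supAbs Ω (Dmix p.1 p.2 f) + ∑ p ∈ idxEq m, hSemi α Ω (Dmix p.1 p.2 f)

/-- the `C^k` sup norm `‖f‖_{k,Ω}` -/
def ckNorm (k : ℕ) (Ω : Set Pt) (f : Pt → ℝ) : ℝ≥0∞ :=
  ∑ p ∈ idxLe k, supAbs Ω (Dmix p.1 p.2 f)

def wSup (k : ℝ) (Γ Ω : Set Pt) (d : ℕ) (g : Pt → ℝ) : ℝ≥0∞ :=
  ⨆ x ∈ Ω, ENNReal.ofReal (infDist x Γ ^ (max ((d : ℝ) + k) 0) * |g x|)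

def wSemi (m : ℕ) (α k : ℝ) (Γ Ω : Set Pt) (g : Pt → ℝ) : ℝ≥0∞ :=
  ⨆ x ∈ Ω, ⨆ y ∈ Ω, ⨆ _ : x ≠ y,
    ENNReal.ofReal ((min (infDist x Γ) (infDist y Γ)) ^ (max ((m : ℝ) + α + k) 0) *
      (|g x - g y| / ‖x - y‖ ^ α))

/-- the weighted Hölder norm `‖f‖^{(k,Γ)}_{m,α,Ω}` -/
def whNorm (m : ℕ) (α k : ℝ) (Γ Ω : Set Pt) (f : Pt → ℝ) : ℝ≥0∞ :=
  ∑ p ∈ idxLe m, wSup k Γ Ω (p.1 + p.2) (Dmix p.1 p.2 f)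
  + ∑ p ∈ idxEq m, wSemi m α k Γ Ω (Dmix p.1 p.2 f)

/-! ### one–dimensional versions, for norms of boundary data -/

def supAbs1 (Ω : Set ℝ) (g : ℝ → ℝ) : ℝ≥0∞ := ⨆ x ∈ Ω, ENNReal.ofReal |g x|

def hSemi1 (α : ℝ) (Ω : Set ℝ) (g : ℝ → ℝ) : ℝ≥0∞ :=
  ⨆ x ∈ Ω, ⨆ y ∈ Ω, ⨆ _ : x ≠ y, ENNReal.ofReal (|g x - g y| / |x - y| ^ α)

/-- the one–dimensional Hölder norm `‖f‖_{m,α,Ω}` -/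
def h1Norm (m : ℕ) (α : ℝ) (Ω : Set ℝ) (f : ℝ → ℝ) : ℝ≥0∞ :=
  ∑ i ∈ Finset.range (m+1), supAbs1 Ω (deriv^[i] f) + hSemi1 α Ω (deriv^[m] f)

def wSup1 (k : ℝ) (Γ Ω : Set ℝ) (d : ℕ) (g : ℝ → ℝ) : ℝ≥0∞ :=
  ⨆ x ∈ Ω, ENNReal.ofReal (infDist x Γ ^ (max ((d : ℝ) + k) 0) * |g x|)

def wSemi1 (m : ℕ) (α k : ℝ) (Γ Ω : Set ℝ) (g : ℝ → ℝ) : ℝ≥0∞ :=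
  ⨆ x ∈ Ω, ⨆ y ∈ Ω, ⨆ _ : x ≠ y,
    ENNReal.ofReal ((min (infDist x Γ) (infDist y Γ)) ^ (max ((m : ℝ) + α + k) 0) *
      (|g x - g y| / |x - y| ^ α))

/-- the one–dimensional weighted Hölder norm `‖f‖^{(k,Γ)}_{m,α,Ω}` -/
def wh1Norm (m : ℕ) (α k : ℝ) (Γ Ω : Set ℝ) (f : ℝ → ℝ) : ℝ≥0∞ :=
  ∑ i ∈ Finset.range (m+1), wSup1 k Γ Ω i (deriv^[i] f) + wSemi1 m α k Γ Ω (deriv^[m] f)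

/-! ### gas quantities and the background solution -/

/-- density as a function of entropy `S` and `ζ = K + Φ − |u|²/2` -/
def Hfun (γ 𝔭 cv S ζ : ℝ) : ℝ := ((γ - 1) * ζ / (γ * 𝔭 * exp (S / cv))) ^ (1 / (γ - 1))

/-- temperature -/
def Tfun (γ 𝔭 cv ρ S : ℝ) : ℝ := (cv * 𝔭 / (γ - 1)) * exp (S / cv) * ρ ^ (γ - 1)

/-- the background Bernoulli constant `B₀ = ū(0)²/2 + γ𝔭e^{S₀/c_v}ρ₀^{γ−1}/(γ−1)` -/
def Bern0 (γ 𝔭 cv S₀ J₀ ρ₀ : ℝ) : ℝ :=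
  (J₀ / ρ₀) ^ 2 / 2 + γ * 𝔭 * exp (S₀ / cv) * ρ₀ ^ (γ - 1) / (γ - 1)

/-- the Bernoulli function of a flow `(ρ, u, v, p)` -/
def BernFn (γ : ℝ) (ρ u v p : Pt → ℝ) : Pt → ℝ :=
  fun y => (u y ^ 2 + v y ^ 2) / 2 + γ * p y / ((γ - 1) * ρ y)

/-- the background electric potential `Φ₀` -/
def Phi0 (Eb : ℝ → ℝ) : Pt → ℝ := fun x => ∫ t in (0:ℝ)..x.1, Eb t

/-- the background velocity potential `φ₀` -/
def phi0 (J₀ : ℝ) (ρb : ℝ → ℝ) : Pt → ℝ := fun x => ∫ t in (0:ℝ)..x.1, J₀ / ρb t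

/-- `(ρb, Eb)` is the subsonic background solution of Proposition 2.1 associated with the
data `(b₀, S₀, J₀, ρ₀, E₀, L)`, with density bounds `ρlow, ρhigh` and subsonicity bound `ν₀`. -/
structure Background (γ 𝔭 cv b₀ J₀ S₀ E₀ ρ₀ L ν₀ ρlow ρhigh : ℝ) (ρb Eb : ℝ → ℝ) : Prop where
  hγ : 1 < γ
  h𝔭 : 0 < 𝔭
  hcv : 0 < cv
  hb₀ : 0 < b₀
  hJ₀ : 0 < J₀
  hS₀ : 0 < S₀
  hL : 0 < L
  hν₀ : 0 < ν₀
  hρlow : 0 < ρlow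
  smooth_rho : ContDiffOn ℝ (⊤ : ℕ∞) ρb (Icc 0 L)
  smooth_E : ContDiffOn ℝ (⊤ : ℕ∞) Eb (Icc 0 L)
  init_rho : ρb 0 = ρ₀
  init_E : Eb 0 = E₀
  ode_rho : ∀ x ∈ Icc 0 L, derivWithin ρb (Icc 0 L) x =
      ρb x * Eb x / (γ * 𝔭 * exp (S₀ / cv) * ρb x ^ (γ - 1) - J₀ ^ 2 / ρb x ^ 2)
  ode_E : ∀ x ∈ Icc 0 L, derivWithin Eb (Icc 0 L) x = ρb x - b₀
  bound_lo : ∀ x ∈ Icc 0 L, ρlow ≤ ρb x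
  bound_hi : ∀ x ∈ Icc 0 L, ρb x ≤ ρhigh
  subsonic : ∀ x ∈ Icc 0 L, ν₀ ≤ γ * 𝔭 * exp (S₀ / cv) * ρb x ^ (γ - 1) - J₀ ^ 2 / ρb x ^ 2

/-! ### sizes of the perturbations -/

/-- `ω₁(b) = ‖b − b₀‖_{α,N}` -/
def om1 (α b₀ L : ℝ) (b : Pt → ℝ) : ℝ≥0∞ := hNorm 0 α (Noz L) (fun x => b x - b₀)

/-- `ω₂(S_en, B_en) = ‖(S_en,B_en) − (S₀,B₀)‖_{1,α,Γ₀}` -/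
def om2 (α S₀ B₀ : ℝ) (Sen Ben : ℝ → ℝ) : ℝ≥0∞ :=
  h1Norm 1 α (Icc 0 1) (fun t => Sen t - S₀) + h1Norm 1 α (Icc 0 1) (fun t => Ben t - B₀)

/-- `ω₃(Φ_bd, p_ex)`, where `Φ_bd` is described by its two traces `Φbd0` on `Γ₀` and
`ΦbdL` on `Γ_L` (as functions of `x₂`), and the background potential vanishes on `Γ₀`. -/
def om3 (γ 𝔭 cv S₀ α L : ℝ) (ρb Eb : ℝ → ℝ) (Φbd0 ΦbdL pex : ℝ → ℝ) : ℝ≥0∞ :=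
  wh1Norm 2 α (-1-α) {0, 1} (Icc 0 1) Φbd0
  + wh1Norm 2 α (-1-α) {0, 1} (Icc 0 1) (fun t => ΦbdL t - ∫ s in (0:ℝ)..L, Eb s)
  + wh1Norm 1 α (-α) {0, 1} (Icc 0 1) (fun t => pex t - 𝔭 * exp (S₀ / cv) * ρb L ^ γ)

/-- the `W^{2,μ}` norm on `Γ₀ ≃ [0,1]` -/
def W2mu (μ : ℝ) (f : ℝ → ℝ) : ℝ :=
  (∫ t in (0:ℝ)..1, (|f t| ^ μ + |deriv f t| ^ μ + |deriv (deriv f) t| ^ μ)) ^ (1 / μ)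

/-- `ω₄(S_en, B_en, Φ_bd) = ‖(S_en, B_en − Φ_bd) − (S₀, B₀)‖_{W^{2,μ}(Γ₀)}` -/
def om4 (μ S₀ B₀ : ℝ) (Sen Ben Φbd0 : ℝ → ℝ) : ℝ :=
  W2mu μ (fun t => Sen t - S₀) + W2mu μ (fun t => Ben t - Φbd0 t - B₀)

/-! ### the nonlinear fluxes and their linearization at the background state -/

def evec : Fin 2 → Pt := fun j => if j = 0 then (1, 0) else (0, 1)

/-- the flux `B(ς,η,z,q,s) = H(ς, η + z − |q + s^⊥|²/2)`, `s^⊥ = (s₂,−s₁)` -/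
def Bflux (γ 𝔭 cv ς η z : ℝ) (q s : Pt) : ℝ :=
  Hfun γ 𝔭 cv ς (η + z - ((q.1 + s.2) ^ 2 + (q.2 - s.1) ^ 2) / 2)

/-- the flux `A_i(ς,η,z,q,s) = B(ς,η,z,q,s)·q_i` -/
def Aflux (γ 𝔭 cv : ℝ) (i : Fin 2) (ς η z : ℝ) (q s : Pt) : ℝ :=
  Bflux γ 𝔭 cv ς η z q s * (if i = 0 then q.1 else q.2)

/-- `𝔞_{ij}(x) = ∂_{q_j}A_i(V₀(x))` at the background state
`V₀(x) = (S₀, K₀, Φ₀(x), (ū(x₁),0), 0)` -/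
def coefa (γ 𝔭 cv S₀ K₀ J₀ : ℝ) (ρb Eb : ℝ → ℝ) (i j : Fin 2) (x : Pt) : ℝ :=
  deriv (fun t : ℝ => Aflux γ 𝔭 cv i S₀ K₀ (Phi0 Eb x) ((J₀ / ρb x.1, 0) + t • evec j) (0, 0)) 0

/-- `𝔟_i(x) = ∂_z A_i(V₀(x))` -/
def coefb (γ 𝔭 cv S₀ K₀ J₀ : ℝ) (ρb Eb : ℝ → ℝ) (i : Fin 2) (x : Pt) : ℝ :=
  deriv (fun t : ℝ => Aflux γ 𝔭 cv i S₀ K₀ (Phi0 Eb x + t) (J₀ / ρb x.1, 0) (0, 0)) 0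

/-- `𝔠_i(x) = ∂_{q_i}B(V₀(x))` -/
def coefc (γ 𝔭 cv S₀ K₀ J₀ : ℝ) (ρb Eb : ℝ → ℝ) (i : Fin 2) (x : Pt) : ℝ :=
  deriv (fun t : ℝ => Bflux γ 𝔭 cv S₀ K₀ (Phi0 Eb x) ((J₀ / ρb x.1, 0) + t • evec i) (0, 0)) 0

/-- `𝔡(x) = ∂_z B(V₀(x))` -/
def coefd (γ 𝔭 cv S₀ K₀ J₀ : ℝ) (ρb Eb : ℝ → ℝ) (x : Pt) : ℝ :=
  deriv (fun t : ℝ => Bflux γ 𝔭 cv S₀ K₀ (Phi0 Eb x + t) (J₀ / ρb x.1, 0) (0, 0)) 0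

theorem hasDerivAt_Hfun {γ 𝔭 cv S ρ : ℝ} (hγ : 1 < γ) (h𝔭 : 0 < 𝔭) (hρ : 0 < ρ) :
    HasDerivAt (Hfun γ 𝔭 cv S) (ρ ^ (2 - γ) / (γ * 𝔭 * exp (S / cv)))
      (γ * 𝔭 * exp (S / cv) * ρ ^ (γ - 1) / (γ - 1)) := by
  have hc : 0 < γ * 𝔭 * exp (S / cv) := by positivity
  unfold Hfun
  set c := γ * 𝔭 * exp (S / cv)
  have hγ' : γ - 1 ≠ 0 := by linarith
  have hpow : 0 < ρ ^ (γ - 1) := by positivity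
  have hbase : (γ - 1) * (c * ρ ^ (γ - 1) / (γ - 1)) / c = ρ ^ (γ - 1) := by
    field_simp
  have hlin : HasDerivAt (fun ζ : ℝ => (γ - 1) * ζ / c) ((γ - 1) * 1 / c)
      (c * ρ ^ (γ - 1) / (γ - 1)) :=
    ((hasDerivAt_id _).const_mul (γ - 1)).div_const c
  have hd := hlin.rpow_const (p := 1 / (γ - 1)) (Or.inl (by rw [hbase]; exact hpow.ne'))
  convert hd using 1
  have hexp : (γ - 1) * (1 / (γ - 1) - 1) = 2 - γ := by
    field_simp
    ring
  rw [hbase, ← rpow_mul hρ.le, hexp]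
  field_simp

/-- Conservation of the pseudo-Bernoulli invariant along the background solution. -/
theorem Background.bernoulli {γ 𝔭 cv b₀ J₀ S₀ E₀ ρ₀ L ν₀ ρlow ρhigh : ℝ} {ρb Eb : ℝ → ℝ}
    (hbg : Background γ 𝔭 cv b₀ J₀ S₀ E₀ ρ₀ L ν₀ ρlow ρhigh ρb Eb)
    {x : Pt} (hx : x.1 ∈ Icc 0 L) :
    Bern0 γ 𝔭 cv S₀ J₀ ρ₀ + Phi0 Eb x = Bern0 γ 𝔭 cv S₀ J₀ (ρb x.1) := by
  have hpos : ∀ y ∈ Icc 0 L, 0 < ρb y := fun y hy => hbg.hρlow.trans_le (hbg.bound_lo y hy)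
  have hsub : Icc 0 x.1 ⊆ Icc 0 L := Icc_subset_Icc_right hx.2
  have hγ' : γ - 1 ≠ 0 := by linarith [hbg.hγ]
  have hcont : ContinuousOn ρb (Icc 0 x.1) := hbg.smooth_rho.continuousOn.mono hsub
  have hcontB : ContinuousOn (fun y => Bern0 γ 𝔭 cv S₀ J₀ (ρb y)) (Icc 0 x.1) := by
    have hne : ∀ y ∈ Icc 0 x.1, ρb y ≠ 0 := fun y hy => (hpos y (hsub hy)).ne'
    unfold Bern0
    exact (((continuousOn_const.div hcont hne).pow 2).div_const 2).add
      ((continuousOn_const.mul (hcont.rpow_const fun y hy => Or.inl (hne y hy))).div_const _)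
  have hderiv : ∀ y ∈ Ioo 0 x.1,
      HasDerivAt (fun y => Bern0 γ 𝔭 cv S₀ J₀ (ρb y)) (Eb y) y := by
    intro y hy
    have hyL : y ∈ Icc 0 L := hsub (Ioo_subset_Icc_self hy)
    have hρ := hpos y hyL
    have hnhds : Icc 0 L ∈ nhds y := Icc_mem_nhds hy.1 (hy.2.trans_le hx.2)
    have hd : HasDerivAt ρb (ρb y * Eb y /
        (γ * 𝔭 * exp (S₀ / cv) * ρb y ^ (γ - 1) - J₀ ^ 2 / ρb y ^ 2)) y := by
      rw [← hbg.ode_rho y hyL]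
      exact ((hbg.smooth_rho.differentiableOn (by simp)) y hyL).hasDerivWithinAt.hasDerivAt hnhds
    have hs : γ * 𝔭 * exp (S₀ / cv) * ρb y ^ (γ - 1) - J₀ ^ 2 / ρb y ^ 2 ≠ 0 :=
      (hbg.hν₀.trans_le (hbg.subsonic y hyL)).ne'
    have hB := (((((hasDerivAt_const y J₀).div hd hρ.ne').pow 2).div_const 2).add
      (((hd.rpow_const (p := γ - 1) (Or.inl hρ.ne')).const_mul
        (γ * 𝔭 * exp (S₀ / cv))).div_const (γ - 1)))
    unfold Bern0
    refine hB.congr_deriv (Eq.symm ?_)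
    have hpow : ρb y ^ (γ - 1 - 1) = ρb y ^ (γ - 1) / ρb y := rpow_sub_one hρ.ne' _
    rw [hpow]
    generalize hD : γ * 𝔭 * exp (S₀ / cv) * ρb y ^ (γ - 1) - J₀ ^ 2 / ρb y ^ 2 = D at hs ⊢
    have hD' : γ * 𝔭 * exp (S₀ / cv) * ρb y ^ (γ - 1) = D + J₀ ^ 2 / ρb y ^ 2 := by
      rw [← hD]; ring
    calc Eb y = (D + J₀ ^ 2 / ρb y ^ 2) * (Eb y / D) - J₀ ^ 2 * Eb y / (ρb y ^ 2 * D) := by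
          field_simp
          ring
      _ = _ := by
          rw [← hD']
          simp only [Pi.div_apply, Nat.add_one_sub_one, pow_one, Nat.cast_ofNat]
          field_simp
          ring
  have hint : IntervalIntegrable Eb volume 0 x.1 :=
    (hbg.smooth_E.continuousOn.mono hsub).intervalIntegrable_of_Icc hx.1
  have h := intervalIntegral.integral_eq_sub_of_hasDerivAt_of_le hx.1 hcontB hderiv hint
  rw [hbg.init_rho] at h
  rw [Phi0, h]
  ring

/-- Chain rule for `Hfun` along a curve passing through the background value of `ζ`, where
`Hfun` takes the value `ρb`. -/
theorem Background.hasDerivAt_Hfun_comp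
    {γ 𝔭 cv b₀ J₀ S₀ E₀ ρ₀ L ν₀ ρlow ρhigh : ℝ} {ρb Eb : ℝ → ℝ}
    (hbg : Background γ 𝔭 cv b₀ J₀ S₀ E₀ ρ₀ L ν₀ ρlow ρhigh ρb Eb)
    {x : Pt} (hx : x.1 ∈ Icc 0 L) {ζ : ℝ → ℝ} {ζ' : ℝ} (hζ : HasDerivAt ζ ζ' 0)
    (hζ0 : ζ 0 = Bern0 γ 𝔭 cv S₀ J₀ ρ₀ + Phi0 Eb x - (J₀ / ρb x.1) ^ 2 / 2) :
    HasDerivAt (fun t => Hfun γ 𝔭 cv S₀ (ζ t))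
      (ρb x.1 ^ (2 - γ) / (γ * 𝔭 * exp (S₀ / cv)) * ζ') 0 := by
  have hρ : 0 < ρb x.1 := hbg.hρlow.trans_le (hbg.bound_lo _ hx)
  have hζ0' : ζ 0 = γ * 𝔭 * exp (S₀ / cv) * ρb x.1 ^ (γ - 1) / (γ - 1) := by
    rw [hζ0, hbg.bernoulli hx, Bern0]
    ring
  have h := hasDerivAt_Hfun (cv := cv) (S := S₀) hbg.hγ hbg.h𝔭 hρ
  rw [← hζ0'] at h
  exact h.comp 0 hζ

/-- Lemma 4.2 (c),(d). For the coefficients obtained by linearizing the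
Euler–Poisson fluxes at the subsonic background solution: (c) `𝔟_i + 𝔠_i = 0` on `N` for
`i = 1,2`, with `𝔟₁ = −𝔠₁ = ρ̄^{2−γ}ū/(γ𝔭e^{S₀/c_v})` and `𝔟₂ = 𝔠₂ = 0`; and (d)
`𝔡 = ρ̄^{2−γ}/(γ𝔭e^{S₀/c_v})` and there is a constant `ν₂ > 0` depending only on the data
with `𝔡 ≥ ν₂` on `N`. -/
theorem stmt8 (γ 𝔭 cv b₀ J₀ S₀ E₀ ρ₀ L ν₀ ρlow ρhigh K₀ : ℝ) (ρb Eb : ℝ → ℝ)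
    (hbg : Background γ 𝔭 cv b₀ J₀ S₀ E₀ ρ₀ L ν₀ ρlow ρhigh ρb Eb)
    (hK₀ : K₀ = Bern0 γ 𝔭 cv S₀ J₀ ρ₀) :
    -- (c): the cancellation identities with explicit formulas
    (∀ x ∈ Noz L, ∀ i : Fin 2,
      coefb γ 𝔭 cv S₀ K₀ J₀ ρb Eb i x + coefc γ 𝔭 cv S₀ K₀ J₀ ρb Eb i x = 0) ∧
    (∀ x ∈ Noz L,
      coefb γ 𝔭 cv S₀ K₀ J₀ ρb Eb 0 x =
        ρb x.1 ^ (2 - γ) * (J₀ / ρb x.1) / (γ * 𝔭 * exp (S₀ / cv)) ∧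
      coefc γ 𝔭 cv S₀ K₀ J₀ ρb Eb 0 x =
        -(ρb x.1 ^ (2 - γ) * (J₀ / ρb x.1) / (γ * 𝔭 * exp (S₀ / cv))) ∧
      coefb γ 𝔭 cv S₀ K₀ J₀ ρb Eb 1 x = 0 ∧
      coefc γ 𝔭 cv S₀ K₀ J₀ ρb Eb 1 x = 0) ∧
    -- (d): the explicit formula and the positive lower bound for `𝔡`
    (∀ x ∈ Noz L,
      coefd γ 𝔭 cv S₀ K₀ J₀ ρb Eb x = ρb x.1 ^ (2 - γ) / (γ * 𝔭 * exp (S₀ / cv))) ∧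
    (∃ ν₂ > (0:ℝ), ∀ x ∈ Noz L, ν₂ ≤ coefd γ 𝔭 cv S₀ K₀ J₀ ρb Eb x) := by
  subst hK₀
  have hN : ∀ x ∈ Noz L, x.1 ∈ Icc 0 L := fun x hx => Ioo_subset_Icc_self hx.1
  have hBz : ∀ x ∈ Noz L, HasDerivAt
      (fun t : ℝ => Bflux γ 𝔭 cv S₀ (Bern0 γ 𝔭 cv S₀ J₀ ρ₀) (Phi0 Eb x + t)
        (J₀ / ρb x.1, 0) (0, 0)) (ρb x.1 ^ (2 - γ) / (γ * 𝔭 * exp (S₀ / cv))) 0 := by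
    intro x hx
    have hζ : HasDerivAt (fun t : ℝ => Bern0 γ 𝔭 cv S₀ J₀ ρ₀ + (Phi0 Eb x + t) -
        ((J₀ / ρb x.1 + 0) ^ 2 + (0 - 0) ^ 2) / 2) 1 0 :=
      (((hasDerivAt_id (0 : ℝ)).const_add _).const_add _).sub_const _
    simpa only [mul_one, Bflux] using hbg.hasDerivAt_Hfun_comp (hN x hx) hζ (by ring)
  have hd : ∀ x ∈ Noz L, coefd γ 𝔭 cv S₀ (Bern0 γ 𝔭 cv S₀ J₀ ρ₀) J₀ ρb Eb x =
      ρb x.1 ^ (2 - γ) / (γ * 𝔭 * exp (S₀ / cv)) := fun x hx => (hBz x hx).deriv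
  have hb0 : ∀ x ∈ Noz L, coefb γ 𝔭 cv S₀ (Bern0 γ 𝔭 cv S₀ J₀ ρ₀) J₀ ρb Eb 0 x =
      ρb x.1 ^ (2 - γ) * (J₀ / ρb x.1) / (γ * 𝔭 * exp (S₀ / cv)) := by
    intro x hx
    refine ((hBz x hx).mul_const (J₀ / ρb x.1)).deriv.trans ?_
    ring
  have hb1 : ∀ x ∈ Noz L, coefb γ 𝔭 cv S₀ (Bern0 γ 𝔭 cv S₀ J₀ ρ₀) J₀ ρb Eb 1 x = 0 := by
    intro x hx
    simp [coefb, Aflux]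
  have hc0 : ∀ x ∈ Noz L, coefc γ 𝔭 cv S₀ (Bern0 γ 𝔭 cv S₀ J₀ ρ₀) J₀ ρb Eb 0 x =
      -(ρb x.1 ^ (2 - γ) * (J₀ / ρb x.1) / (γ * 𝔭 * exp (S₀ / cv))) := by
    intro x hx
    have hζ : HasDerivAt (fun t : ℝ => Bern0 γ 𝔭 cv S₀ J₀ ρ₀ + Phi0 Eb x -
        (J₀ / ρb x.1 + t) ^ 2 / 2) (-(J₀ / ρb x.1)) 0 := by
      refine (((((hasDerivAt_id (0 : ℝ)).const_add (J₀ / ρb x.1)).pow 2).div_const 2).const_sub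
        (Bern0 γ 𝔭 cv S₀ J₀ ρ₀ + Phi0 Eb x)).congr_deriv ?_
      simp
    have h := (hbg.hasDerivAt_Hfun_comp (hN x hx) hζ (by ring)).deriv
    simp only [coefc, Bflux, evec]
    norm_num
    rw [h]
    ring
  have hc1 : ∀ x ∈ Noz L, coefc γ 𝔭 cv S₀ (Bern0 γ 𝔭 cv S₀ J₀ ρ₀) J₀ ρb Eb 1 x = 0 := by
    intro x hx
    have hζ : HasDerivAt (fun t : ℝ => Bern0 γ 𝔭 cv S₀ J₀ ρ₀ + Phi0 Eb x -
        ((J₀ / ρb x.1) ^ 2 + t ^ 2) / 2) 0 0 := by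
      refine (((((hasDerivAt_id (0 : ℝ)).pow 2).const_add ((J₀ / ρb x.1) ^ 2)).div_const
        2).const_sub (Bern0 γ 𝔭 cv S₀ J₀ ρ₀ + Phi0 Eb x)).congr_deriv ?_
      simp
    have h := (hbg.hasDerivAt_Hfun_comp (hN x hx) hζ (by ring)).deriv
    simp only [coefc, Bflux, evec]
    norm_num
    rw [h]
    ring
  refine ⟨?_, fun x hx => ⟨hb0 x hx, hc0 x hx, hb1 x hx, hc1 x hx⟩, hd, ?_⟩
  · intro x hx i
    fin_cases i
    · simp [hb0 x hx, hc0 x hx]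
    · simp [hb1 x hx, hc1 x hx]
  · have hc : 0 < γ * 𝔭 * exp (S₀ / cv) := by
      have := hbg.hγ
      have := hbg.h𝔭
      positivity
    have h0 : (0 : ℝ) ∈ Icc 0 L := ⟨le_rfl, hbg.hL.le⟩
    have hlow := hbg.hρlow
    have hhigh : 0 < ρhigh := hlow.trans_le ((hbg.bound_lo 0 h0).trans (hbg.bound_hi 0 h0))
    refine ⟨min (ρlow ^ (2 - γ)) (ρhigh ^ (2 - γ)) / (γ * 𝔭 * exp (S₀ / cv)),
      by positivity, fun x hx => ?_⟩
    rw [hd x hx]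
    have hlo := hbg.bound_lo _ (hN x hx)
    gcongr
    rcases le_total 0 (2 - γ) with h | h
    · exact (min_le_left _ _).trans (rpow_le_rpow hlow.le hlo h)
    · exact (min_le_right _ _).trans
        (rpow_le_rpow_of_nonpos (hlow.trans_le hlo) (hbg.bound_hi _ (hN x hx)) h)
end
end

section
/- Fix α∈(0,1), K₀>0 and ν*>0. Suppose a vector field V=(V₁,V₂) on N̄ satisfies div V = 0 in N, V·n_w = 0 on Γ_w, the weighted Hölder bound ‖V‖^{(−α,Γ̄_w)}_{1,α,N} ≤ K₀, and V₁ ≥ ν* on N̄. Then for any W_en ∈ C^{1,α}(Γ₀;ℝ²) and any constant vector W₀∈ℝ², the transport problem V·∇W = 0 in N with W = W_en on Γ₀ has a unique solution W ∈ C^{1,α}(N̄;ℝ²), and it satisfies ‖W − W₀‖_{1,α,N} ≤ C* ‖W_en − W₀‖_{1,α,Γ₀}, where the constant C* depends only on L, ν*, K₀ and α. -/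
open Real Set Metric MeasureTheory
open scoped ENNReal

noncomputable section

/-- `W` is a `C^{1,α}(N̄)`-solution of the transport problem `V·∇W = 0` in `N`,
`W = W_en` on `Γ₀`. -/
def TranSol (L : ℝ) (V₁ V₂ : Pt → ℝ) (Wen : ℝ → ℝ) (W : Pt → ℝ) : Prop :=
  UpTo 1 W (closure (Noz L)) ∧
  (∀ x ∈ Noz L, V₁ x * pd1 W x + V₂ x * pd2 W x = 0) ∧
  (∀ t ∈ Icc (0:ℝ) 1, W (0, t) = Wen t)


/-! ### Extension of `C¹` functions across the boundary of a rectangle -/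

/-- the nearest point of `[a, b]` -/
def clamp (a b x : ℝ) : ℝ := max a (min x b)

/-- the reflection of `x` about the nearest point of `[a, b]` -/
def fold (a b x : ℝ) : ℝ := 2 * clamp a b x - x

/-- the linear form on the plane with gradient `(p, q)` -/
def gradCLM (p q : ℝ) : Pt →L[ℝ] ℝ :=
  p • ContinuousLinearMap.fst ℝ ℝ ℝ + q • ContinuousLinearMap.snd ℝ ℝ ℝ

theorem gradCLM_apply (p q : ℝ) (z : Pt) : gradCLM p q z = p * z.1 + q * z.2 := by
  simp [gradCLM]

theorem clamp_of_le {a b x : ℝ} (h : x ≤ a) : clamp a b x = a :=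
  max_eq_left ((min_le_left _ _).trans h)

theorem clamp_of_ge {a b x : ℝ} (hab : a ≤ b) (h : b ≤ x) : clamp a b x = b := by
  rw [clamp, min_eq_right h, max_eq_right hab]

theorem clamp_of_mem {a b x : ℝ} (h : x ∈ Icc a b) : clamp a b x = x := by
  rw [clamp, min_eq_left h.2, max_eq_right h.1]

theorem clamp_mem {a b : ℝ} (hab : a ≤ b) (x : ℝ) : clamp a b x ∈ Icc a b :=
  ⟨le_max_left _ _, max_le hab (min_le_right _ _)⟩

theorem continuous_clamp (a b : ℝ) : Continuous (clamp a b) :=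
  continuous_const.max (continuous_id.min continuous_const)

theorem continuous_fold (a b : ℝ) : Continuous (fold a b) :=
  (continuous_const.mul (continuous_clamp a b)).sub continuous_id

theorem fold_of_mem {a b x : ℝ} (h : x ∈ Icc a b) : fold a b x = x := by
  rw [fold, clamp_of_mem h]
  ring

theorem fold_mem {a b x : ℝ} (hab : a < b) (hx : x ∈ Ioo (2 * a - b) (2 * b - a)) :
    fold a b x ∈ Icc a b := by
  rcases le_total x a with h | h
  · rw [fold, clamp_of_le h]
    exact ⟨by linarith, by linarith [hx.1]⟩
  rcases le_total x b with h' | h'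
  · rw [fold_of_mem ⟨h, h'⟩]
    exact ⟨h, h'⟩
  · rw [fold, clamp_of_ge hab.le h']
    exact ⟨by linarith [hx.2], by linarith⟩

open Filter Topology in
/-- Odd reflection about both end points extends a differentiable function from `[a, b]`. -/
theorem hasDerivAt_reflect_extension {f g : ℝ → ℝ} {a b x : ℝ} (hab : a < b)
    (hf : ∀ t ∈ Icc a b, HasDerivWithinAt f (g t) (Icc a b) t)
    (hx : x ∈ Ioo (2 * a - b) (2 * b - a)) :
    HasDerivAt (fun t => 2 * f (clamp a b t) - f (fold a b t)) (g (fold a b x)) x := by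
  have key : ∀ s : Set ℝ, IsClosed s → (∀ t ∈ s, HasDerivWithinAt
      (fun t => 2 * f (clamp a b t) - f (fold a b t)) (g (fold a b t)) s t) →
      HasDerivWithinAt (fun t => 2 * f (clamp a b t) - f (fold a b t)) (g (fold a b x)) s x := by
    intro s hs h
    by_cases hxs : x ∈ s
    · exact h x hxs
    · exact HasFDerivWithinAt.of_notMem_closure (by rwa [hs.closure_eq])
  have hA := key (Icc (2 * a - b) a) isClosed_Icc (by
    intro t ht
    have e : ∀ u ∈ Icc (2 * a - b) a,
        2 * f (clamp a b u) - f (fold a b u) = 2 * f a - f (2 * a - u) := by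
      intro u hu
      rw [fold, clamp_of_le hu.2]
    have hr : fold a b t = 2 * a - t := by rw [fold, clamp_of_le ht.2]
    rw [hr]
    refine HasDerivWithinAt.congr ?_ e (e t ht)
    have h1 : HasDerivWithinAt (fun u : ℝ => 2 * a - u) (-1) (Icc (2 * a - b) a) t :=
      ((hasDerivAt_id t).const_sub (2 * a)).hasDerivWithinAt
    have h2 := (hf (2 * a - t) ⟨by linarith [ht.2], by linarith [ht.1]⟩).comp t h1
      (fun u hu => ⟨by linarith [hu.2], by linarith [hu.1]⟩)
    simpa using! h2.const_sub (2 * f a))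
  have hB := key (Icc a b) isClosed_Icc (by
    intro t ht
    have e : ∀ u ∈ Icc a b, 2 * f (clamp a b u) - f (fold a b u) = f u := by
      intro u hu
      rw [fold, clamp_of_mem hu]
      ring_nf
    have hr : fold a b t = t := fold_of_mem ht
    rw [hr]
    exact (hf t ht).congr e (e t ht))
  have hC := key (Icc b (2 * b - a)) isClosed_Icc (by
    intro t ht
    have e : ∀ u ∈ Icc b (2 * b - a),
        2 * f (clamp a b u) - f (fold a b u) = 2 * f b - f (2 * b - u) := by
      intro u hu
      rw [fold, clamp_of_ge hab.le hu.1]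
    have hr : fold a b t = 2 * b - t := by rw [fold, clamp_of_ge hab.le ht.1]
    rw [hr]
    refine HasDerivWithinAt.congr ?_ e (e t ht)
    have h1 : HasDerivWithinAt (fun u : ℝ => 2 * b - u) (-1) (Icc b (2 * b - a)) t :=
      ((hasDerivAt_id t).const_sub (2 * b)).hasDerivWithinAt
    have h2 := (hf (2 * b - t) ⟨by linarith [ht.2], by linarith [ht.1]⟩).comp t h1
      (fun u hu => ⟨by linarith [hu.2], by linarith [hu.1]⟩)
    simpa using! h2.const_sub (2 * f b))
  refine ((hA.union hB).union hC).hasDerivAt ?_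
  filter_upwards [Ioo_mem_nhds hx.1 hx.2] with u hu
  rcases le_total u a with h | h
  · exact Or.inl (Or.inl ⟨hu.1.le, h⟩)
  rcases le_total u b with h' | h'
  · exact Or.inl (Or.inr ⟨h, h'⟩)
  · exact Or.inr ⟨h', hu.2.le⟩

open Filter Topology in
/-- A function with continuous partial derivatives on an open set is `C¹` there. -/
theorem hasFDerivAt_and_contDiffOn_of_partials {U : Set Pt} (hU : IsOpen U) {f g₁ g₂ : Pt → ℝ}
    (h₁ : ∀ z ∈ U, HasDerivAt (fun t => f (t, z.2)) (g₁ z) z.1)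
    (h₂ : ∀ z ∈ U, HasDerivAt (fun t => f (z.1, t)) (g₂ z) z.2)
    (c₁ : ContinuousOn g₁ U) (c₂ : ContinuousOn g₂ U) :
    (∀ z ∈ U, HasFDerivAt f (gradCLM (g₁ z) (g₂ z)) z) ∧ ContDiffOn ℝ 1 f U := by
  have hd : ∀ z ∈ U, HasFDerivAt f (gradCLM (g₁ z) (g₂ z)) z := by
    intro z hz
    have hc₁ := c₁.continuousAt (hU.mem_nhds hz)
    have hc₂ := c₂.continuousAt (hU.mem_nhds hz)
    have := hasStrictFDerivAt_uncurry_coprod (𝕜 := ℝ) (u := z) (f := fun x y => f (x, y))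
      (f₁ := fun x y => ContinuousLinearMap.toSpanSingleton ℝ (g₁ (x, y)))
      (f₂ := fun x y => ContinuousLinearMap.toSpanSingleton ℝ (g₂ (x, y)))
      (by filter_upwards [hU.mem_nhds hz] with w hw using (h₁ w hw).hasFDerivAt)
      (by filter_upwards [hU.mem_nhds hz] with w hw using (h₂ w hw).hasFDerivAt)
      ((ContinuousLinearMap.toSpanSingletonCLE (𝕜 := ℝ) (E := ℝ)).continuous.continuousAt.comp hc₁)
      ((ContinuousLinearMap.toSpanSingletonCLE (𝕜 := ℝ) (E := ℝ)).continuous.continuousAt.comp hc₂)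
    refine this.hasFDerivAt.congr_fderiv ?_
    ext <;> simp [gradCLM, Function.HasUncurry.uncurry]
  refine ⟨hd, ?_⟩
  have h1 : (1 : WithTop ℕ∞) = 0 + 1 := by simp
  rw [h1, contDiffOn_succ_iff_fderiv_of_isOpen hU]
  refine ⟨fun z hz => (hd z hz).differentiableAt.differentiableWithinAt, by simp, ?_⟩
  rw [contDiffOn_zero]
  refine ContinuousOn.congr (f := fun z => gradCLM (g₁ z) (g₂ z)) ?_ (fun z hz => (hd z hz).fderiv)
  unfold gradCLM
  fun_prop

/-- A function with continuous partial derivatives on a closed rectangle extends to a function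
that is `C¹` on a neighbourhood of the rectangle. -/
theorem exists_contDiffOn_extension {a b c d : ℝ} (hab : a < b) (hcd : c < d) {f g₁ g₂ : Pt → ℝ}
    (h₁ : ∀ z ∈ Icc a b ×ˢ Icc c d,
      HasDerivWithinAt (fun t => f (t, z.2)) (g₁ z) (Icc a b) z.1)
    (h₂ : ∀ z ∈ Icc a b ×ˢ Icc c d,
      HasDerivWithinAt (fun t => f (z.1, t)) (g₂ z) (Icc c d) z.2)
    (c₁ : ContinuousOn g₁ (Icc a b ×ˢ Icc c d)) (c₂ : ContinuousOn g₂ (Icc a b ×ˢ Icc c d)) :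
    ∃ (F : Pt → ℝ) (U : Set Pt), IsOpen U ∧ Icc a b ×ˢ Icc c d ⊆ U ∧
      EqOn F f (Icc a b ×ˢ Icc c d) ∧ ContDiffOn ℝ 1 F U ∧
      ∀ z ∈ Icc a b ×ˢ Icc c d, HasFDerivAt F (gradCLM (g₁ z) (g₂ z)) z := by
  let F : Pt → ℝ := fun z =>
    2 * (2 * f (clamp a b z.1, clamp c d z.2) - f (clamp a b z.1, fold c d z.2)) -
      (2 * f (fold a b z.1, clamp c d z.2) - f (fold a b z.1, fold c d z.2))
  let U : Set Pt := Ioo (2 * a - b) (2 * b - a) ×ˢ Ioo (2 * c - d) (2 * d - c)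
  have hU : IsOpen U := isOpen_Ioo.prod isOpen_Ioo
  have hRU : Icc a b ×ˢ Icc c d ⊆ U := by
    rintro ⟨x, y⟩ ⟨⟨h1, h2⟩, h3, h4⟩
    simp only at h1 h2 h3 h4
    exact ⟨⟨by linarith, by linarith⟩, by simp only; linarith, by simp only; linarith⟩
  have key := hasFDerivAt_and_contDiffOn_of_partials hU (f := F)
    (g₁ := fun z => 2 * g₁ (fold a b z.1, clamp c d z.2) - g₁ (fold a b z.1, fold c d z.2))
    (g₂ := fun z => 2 * g₂ (clamp a b z.1, fold c d z.2) - g₂ (fold a b z.1, fold c d z.2))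
    ?_ ?_ ?_ ?_
  · refine ⟨F, U, hU, hRU, ?_, key.2, ?_⟩
    · rintro ⟨x, y⟩ ⟨hx, hy⟩
      simp only [F, fold_of_mem hx, fold_of_mem hy, clamp_of_mem hx, clamp_of_mem hy]
      ring
    · intro z hz
      have := key.1 z (hRU hz)
      simp only [fold_of_mem hz.1, fold_of_mem hz.2, clamp_of_mem hz.1, clamp_of_mem hz.2] at this
      convert this using 2 <;> ring
  · rintro ⟨x, y⟩ ⟨hx, hy⟩
    have hy1 := clamp_mem hcd.le y
    have hy2 := fold_mem hcd hy
    have := hasDerivAt_reflect_extension hab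
      (f := fun t => 2 * f (t, clamp c d y) - f (t, fold c d y))
      (g := fun t => 2 * g₁ (t, clamp c d y) - g₁ (t, fold c d y))
      (fun t ht => ((h₁ (t, clamp c d y) ⟨ht, hy1⟩).const_mul 2).sub
        (h₁ (t, fold c d y) ⟨ht, hy2⟩)) hx
    exact this
  · rintro ⟨x, y⟩ ⟨hx, hy⟩
    have hx1 := clamp_mem hab.le x
    have hx2 := fold_mem hab hx
    have := hasDerivAt_reflect_extension hcd
      (f := fun t => 2 * f (clamp a b x, t) - f (fold a b x, t))
      (g := fun t => 2 * g₂ (clamp a b x, t) - g₂ (fold a b x, t))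
      (fun t ht => ((h₂ (clamp a b x, t) ⟨hx1, ht⟩).const_mul 2).sub
        (h₂ (fold a b x, t) ⟨hx2, ht⟩)) hy
    refine this.congr_of_eventuallyEq (Filter.Eventually.of_forall fun t => ?_)
    simp only [F]
    ring
  · refine (continuousOn_const.mul (c₁.comp ?_ ?_)).sub (c₁.comp ?_ ?_)
    · exact (((continuous_fold a b).comp continuous_fst).prodMk
        ((continuous_clamp c d).comp continuous_snd)).continuousOn
    · exact fun z hz => ⟨fold_mem hab hz.1, clamp_mem hcd.le _⟩
    · exact (((continuous_fold a b).comp continuous_fst).prodMk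
        ((continuous_fold c d).comp continuous_snd)).continuousOn
    · exact fun z hz => ⟨fold_mem hab hz.1, fold_mem hcd hz.2⟩
  · refine (continuousOn_const.mul (c₂.comp ?_ ?_)).sub (c₂.comp ?_ ?_)
    · exact (((continuous_clamp a b).comp continuous_fst).prodMk
        ((continuous_fold c d).comp continuous_snd)).continuousOn
    · exact fun z hz => ⟨clamp_mem hab.le _, fold_mem hcd hz.2⟩
    · exact (((continuous_fold a b).comp continuous_fst).prodMk
        ((continuous_fold c d).comp continuous_snd)).continuousOn
    · exact fun z hz => ⟨fold_mem hab hz.1, fold_mem hcd hz.2⟩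


/-! ### Hölder continuity from weighted derivative bounds -/

theorem rpow_sub_rpow_le {α s t : ℝ} (hα : α ∈ Ioo (0 : ℝ) 1) (hs : 0 ≤ s) (hst : s ≤ t) :
    t ^ α - s ^ α ≤ (t - s) ^ α := by
  have := Real.rpow_add_le_add_rpow hs (sub_nonneg.2 hst) hα.1.le hα.2.le
  rw [add_sub_cancel] at this
  linarith

theorem min_rpow_le_add {α t : ℝ} (ht : t ∈ Ioo (0 : ℝ) 1) :
    (min t (1 - t)) ^ (α - 1) ≤ t ^ (α - 1) + (1 - t) ^ (α - 1) := by
  have h1 := Real.rpow_nonneg ht.1.le (α - 1)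
  have h2 := Real.rpow_nonneg (sub_nonneg.2 ht.2.le) (α - 1)
  rcases min_choice t (1 - t) with h | h <;> rw [h] <;> linarith

/-- A derivative that blows up at most like `dist(t, {0,1}) ^ (α - 1)` forces `C^α`. -/
theorem abs_sub_le_of_abs_deriv_le {f f' : ℝ → ℝ} {α K : ℝ} (hα : α ∈ Ioo (0 : ℝ) 1) (hK : 0 ≤ K)
    (hf : ∀ t ∈ Ioo (0 : ℝ) 1, HasDerivAt f (f' t) t)
    (hb : ∀ t ∈ Ioo (0 : ℝ) 1, |f' t| ≤ K * (min t (1 - t)) ^ (α - 1))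
    {s t : ℝ} (hs : s ∈ Ioo (0 : ℝ) 1) (ht : t ∈ Ioo (0 : ℝ) 1) :
    |f s - f t| ≤ 2 * K / α * |s - t| ^ α := by
  wlog hst : s ≤ t generalizing s t
  · rw [abs_sub_comm, abs_sub_comm s]
    exact this ht hs (le_of_not_ge hst)
  let g : ℝ → ℝ := fun u => K / α * (u ^ α - (1 - u) ^ α)
  have hg : ∀ u ∈ Ioo (0 : ℝ) 1,
      HasDerivAt g (K * (u ^ (α - 1) + (1 - u) ^ (α - 1))) u := by
    intro u hu
    have h1 := Real.hasDerivAt_rpow_const (x := u) (p := α) (Or.inl hu.1.ne')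
    have h2 := ((hasDerivAt_id u).const_sub 1).rpow_const (p := α)
      (Or.inl (sub_pos.2 hu.2).ne')
    refine ((h1.sub h2).const_mul (K / α)).congr_deriv ?_
    have := hα.1.ne'
    simp only [id]
    field_simp
    ring
  have hmono : ∀ σ : ℝ, |σ| ≤ 1 → MonotoneOn (fun u => g u + σ * f u) (Ioo 0 1) := by
    intro σ hσ
    have hd : ∀ u ∈ Ioo (0 : ℝ) 1, HasDerivAt (fun u => g u + σ * f u)
        (K * (u ^ (α - 1) + (1 - u) ^ (α - 1)) + σ * f' u) u :=
      fun u hu => (hg u hu).add ((hf u hu).const_mul σ)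
    refine monotoneOn_of_deriv_nonneg (convex_Ioo 0 1)
      (fun u hu => (hd u hu).continuousAt.continuousWithinAt) ?_ ?_
    · rw [interior_Ioo]
      exact fun u hu => (hd u hu).differentiableAt.differentiableWithinAt
    · rw [interior_Ioo]
      intro u hu
      rw [(hd u hu).deriv]
      have h1 : |σ * f' u| ≤ 1 * |f' u| := by
        rw [abs_mul]
        gcongr
      have h2 := hb u hu
      have h3 := mul_le_mul_of_nonneg_left (min_rpow_le_add (α := α) hu) hK
      linarith [neg_abs_le (σ * f' u)]
  have h1 := hmono 1 (by simp) hs ht hst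
  have h2 := hmono (-1) (by simp) hs ht hst
  simp only [one_mul, neg_mul] at h1 h2
  have h3 : g t - g s ≤ 2 * K / α * (t - s) ^ α := by
    have e1 := rpow_sub_rpow_le hα hs.1.le hst
    have e2 := rpow_sub_rpow_le hα (s := 1 - t) (t := 1 - s) (by linarith [ht.2]) (by linarith)
    have e3 : 1 - s - (1 - t) = t - s := by ring
    rw [e3] at e2
    have : 0 ≤ K / α := div_nonneg hK hα.1.le
    calc g t - g s = K / α * ((t ^ α - s ^ α) + ((1 - s) ^ α - (1 - t) ^ α)) := by
          simp only [g]; ring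
      _ ≤ K / α * ((t - s) ^ α + (t - s) ^ α) := by gcongr
      _ = _ := by ring
  rw [abs_sub_comm s, abs_of_nonneg (sub_nonneg.2 hst), abs_le]
  constructor <;> linarith

theorem hasDerivAt_pd1 {f : Pt → ℝ} {x y : ℝ} (hf : DifferentiableAt ℝ f (x, y)) :
    HasDerivAt (fun t => f (t, y)) (pd1 f (x, y)) x :=
  hf.hasFDerivAt.comp_hasDerivAt x ((hasDerivAt_id x).prodMk (hasDerivAt_const x y))

theorem hasDerivAt_pd2 {f : Pt → ℝ} {x y : ℝ} (hf : DifferentiableAt ℝ f (x, y)) :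
    HasDerivAt (fun t => f (x, t)) (pd2 f (x, y)) y :=
  hf.hasFDerivAt.comp_hasDerivAt y ((hasDerivAt_const y x).prodMk (hasDerivAt_id y))

theorem isOpen_Noz (L : ℝ) : IsOpen (Noz L) := isOpen_Ioo.prod isOpen_Ioo

theorem closure_Noz {L : ℝ} (hL : 0 < L) : closure (Noz L) = Icc 0 L ×ˢ Icc 0 1 := by
  rw [Noz, closure_prod_eq, closure_Ioo hL.ne, closure_Ioo zero_ne_one]

theorem min_le_infDist {L : ℝ} (hL : 0 < L) {z : Pt} (hz : z ∈ Noz L) :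
    min z.2 (1 - z.2) ≤ infDist z (GamWbar L) := by
  have hne : (GamWbar L).Nonempty := ⟨(0, 0), ⟨le_rfl, hL.le⟩, by simp⟩
  rw [le_infDist hne]
  rintro ⟨a, b⟩ ⟨-, hb⟩
  refine le_trans ?_ (le_max_right _ _)
  obtain ⟨-, h1, h2⟩ := hz
  simp only [mem_insert_iff, mem_singleton_iff] at hb
  rw [Real.dist_eq]
  rcases hb with rfl | rfl
  · simp only [sub_zero]
    exact (min_le_left _ _).trans (le_abs_self _)
  · rw [abs_sub_comm]
    exact (min_le_right _ _).trans (le_abs_self _)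

theorem idxLe_one : idxLe 1 = {(0, 0), (0, 1), (1, 0)} := by decide

theorem idxEq_one : idxEq 1 = {(0, 1), (1, 0)} := by decide

theorem wSup_le_whNorm {m : ℕ} {α k : ℝ} {Γ Ω : Set Pt} {f : Pt → ℝ} {p : ℕ × ℕ}
    (hp : p ∈ idxLe m) : wSup k Γ Ω (p.1 + p.2) (Dmix p.1 p.2 f) ≤ whNorm m α k Γ Ω f :=
  le_trans (Finset.single_le_sum (f := fun p : ℕ × ℕ => wSup k Γ Ω (p.1 + p.2) (Dmix p.1 p.2 f))
    (fun _ _ => zero_le) hp) le_self_add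

theorem bound_of_wSup_le {k K : ℝ} {Γ Ω : Set Pt} {d : ℕ} {g : Pt → ℝ} (hK : 0 ≤ K)
    (h : wSup k Γ Ω d g ≤ ENNReal.ofReal K) {z : Pt} (hz : z ∈ Ω) :
    infDist z Γ ^ (max ((d : ℝ) + k) 0) * |g z| ≤ K :=
  (ENNReal.ofReal_le_ofReal_iff hK).1 ((le_iSup₂_of_le (f := fun x (_ : x ∈ Ω) =>
    ENNReal.ofReal (infDist x Γ ^ (max ((d : ℝ) + k) 0) * |g x|)) z hz le_rfl).trans h)

theorem abs_le_of_whNorm_le {L α K : ℝ} (hα : α ∈ Ioo (0 : ℝ) 1) (hK : 0 ≤ K) {V : Pt → ℝ}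
    (h : whNorm 1 α (-α) (GamWbar L) (Noz L) V ≤ ENNReal.ofReal K) {z : Pt} (hz : z ∈ Noz L) :
    |V z| ≤ K := by
  have := bound_of_wSup_le hK
    ((wSup_le_whNorm (p := (0, 0)) (by rw [idxLe_one]; simp)).trans h) hz
  simpa [Dmix, max_eq_right (neg_nonpos.2 hα.1.le)] using this

theorem le_mul_min_rpow {L α K c : ℝ} (hL : 0 < L) (hα : α ∈ Ioo (0 : ℝ) 1) {z : Pt}
    (hz : z ∈ Noz L) (hc : 0 ≤ c)
    (h : infDist z (GamWbar L) ^ (max (((1 : ℕ) : ℝ) + -α) 0) * c ≤ K) :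
    c ≤ K * (min z.2 (1 - z.2)) ^ (α - 1) := by
  have hm : 0 < min z.2 (1 - z.2) := lt_min hz.2.1 (sub_pos.2 hz.2.2)
  have e : max (((1 : ℕ) : ℝ) + -α) 0 = 1 - α := by
    rw [max_eq_left] <;> push_cast <;> linarith [hα.2]
  rw [e] at h
  have h1 : (min z.2 (1 - z.2)) ^ (1 - α) * c ≤ K :=
    le_trans (mul_le_mul_of_nonneg_right
      (Real.rpow_le_rpow hm.le (min_le_infDist hL hz) (by linarith [hα.2])) hc) h
  have h2 : (min z.2 (1 - z.2)) ^ (α - 1) * (min z.2 (1 - z.2)) ^ (1 - α) = 1 := by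
    rw [← Real.rpow_add hm]
    simp
  calc c = (min z.2 (1 - z.2)) ^ (α - 1) * ((min z.2 (1 - z.2)) ^ (1 - α) * c) := by
        rw [← mul_assoc, h2, one_mul]
    _ ≤ (min z.2 (1 - z.2)) ^ (α - 1) * K := by gcongr
    _ = _ := mul_comm _ _

theorem abs_pd1_le_of_whNorm_le {L α K : ℝ} (hL : 0 < L) (hα : α ∈ Ioo (0 : ℝ) 1) (hK : 0 ≤ K)
    {V : Pt → ℝ} (h : whNorm 1 α (-α) (GamWbar L) (Noz L) V ≤ ENNReal.ofReal K) {z : Pt}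
    (hz : z ∈ Noz L) : |pd1 V z| ≤ K * (min z.2 (1 - z.2)) ^ (α - 1) :=
  le_mul_min_rpow hL hα hz (abs_nonneg _) (bound_of_wSup_le hK
    ((wSup_le_whNorm (p := (1, 0)) (by rw [idxLe_one]; simp)).trans h) hz)

theorem abs_pd2_le_of_whNorm_le {L α K : ℝ} (hL : 0 < L) (hα : α ∈ Ioo (0 : ℝ) 1) (hK : 0 ≤ K)
    {V : Pt → ℝ} (h : whNorm 1 α (-α) (GamWbar L) (Noz L) V ≤ ENNReal.ofReal K) {z : Pt}
    (hz : z ∈ Noz L) : |pd2 V z| ≤ K * (min z.2 (1 - z.2)) ^ (α - 1) :=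
  le_mul_min_rpow hL hα hz (abs_nonneg _) (bound_of_wSup_le hK
    ((wSup_le_whNorm (p := (0, 1)) (by rw [idxLe_one]; simp)).trans h) hz)

/-- Hölder continuity in the vertical direction. -/
theorem abs_sub_le_vertical {L α K : ℝ} (hL : 0 < L) (hα : α ∈ Ioo (0 : ℝ) 1) (hK : 0 ≤ K)
    {V : Pt → ℝ} (hV : DifferentiableOn ℝ V (Noz L))
    (h : whNorm 1 α (-α) (GamWbar L) (Noz L) V ≤ ENNReal.ofReal K) {x s t : ℝ}
    (hx : x ∈ Ioo 0 L) (hs : s ∈ Ioo (0 : ℝ) 1) (ht : t ∈ Ioo (0 : ℝ) 1) :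
    |V (x, s) - V (x, t)| ≤ 2 * K / α * |s - t| ^ α :=
  abs_sub_le_of_abs_deriv_le (f := fun u => V (x, u)) (f' := fun u => pd2 V (x, u)) hα hK
    (fun _ hu => hasDerivAt_pd2 (hV.differentiableAt ((isOpen_Noz L).mem_nhds ⟨hx, hu⟩)))
    (fun _ hu => abs_pd2_le_of_whNorm_le hL hα hK h ⟨hx, hu⟩) hs ht

theorem abs_sub_le_horizontal {L α K : ℝ} (hL : 0 < L) (hα : α ∈ Ioo (0 : ℝ) 1) (hK : 0 ≤ K)
    {V : Pt → ℝ} (hV : DifferentiableOn ℝ V (Noz L))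
    (h : whNorm 1 α (-α) (GamWbar L) (Noz L) V ≤ ENNReal.ofReal K) {x x' y : ℝ}
    (hx : x ∈ Ioo 0 L) (hx' : x' ∈ Ioo 0 L) (hy : y ∈ Ioo (0 : ℝ) 1) :
    |V (x, y) - V (x', y)| ≤ K * (min y (1 - y)) ^ (α - 1) * |x - x'| :=
  Convex.norm_image_sub_le_of_norm_hasDerivWithin_le (f := fun u => V (u, y))
    (f' := fun u => pd1 V (u, y)) (s := Ioo 0 L)
    (fun _ hu => (hasDerivAt_pd1
      (hV.differentiableAt ((isOpen_Noz L).mem_nhds ⟨hu, hy⟩))).hasDerivWithinAt)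
    (fun _ hu => abs_pd1_le_of_whNorm_le hL hα hK h ⟨hu, hy⟩)
    (convex_Ioo 0 L) hx' hx

/-- The weighted norm `‖·‖^{(-α,Γ̄_w)}_{1,α}` controls the `C^α` seminorm. -/
theorem abs_sub_le_of_whNorm_le {L α K : ℝ} (hL : 0 < L) (hα : α ∈ Ioo (0 : ℝ) 1) (hK : 0 ≤ K)
    {V : Pt → ℝ} (hV : DifferentiableOn ℝ V (Noz L))
    (h : whNorm 1 α (-α) (GamWbar L) (Noz L) V ≤ ENNReal.ofReal K) {p q : Pt}
    (hp : p ∈ Noz L) (hq : q ∈ Noz L) :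
    |V p - V q| ≤ (6 * K / α + 4 * K) * ‖p - q‖ ^ α := by
  obtain ⟨x, y⟩ := p
  obtain ⟨x', y'⟩ := q
  obtain ⟨hx, hy⟩ := hp
  obtain ⟨hx', hy'⟩ := hq
  simp only at hx hy hx' hy'
  have hα0 := hα.1
  set r := ‖((x, y) : Pt) - (x', y')‖ with hr
  have hr1 : |x - x'| ≤ r := norm_fst_le (((x, y) : Pt) - (x', y'))
  have hr2 : |y - y'| ≤ r := norm_snd_le (((x, y) : Pt) - (x', y'))
  have hr0 : 0 ≤ r := norm_nonneg _
  have hrα : 0 ≤ r ^ α := Real.rpow_nonneg hr0 α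
  have hKα : 0 ≤ K / α := div_nonneg hK hα0.le
  rcases le_or_gt (1 / 2) r with hbig | hsmall
  · have e1 := abs_le_of_whNorm_le hα hK h (z := (x, y)) ⟨hx, hy⟩
    have e2 := abs_le_of_whNorm_le hα hK h (z := (x', y')) ⟨hx', hy'⟩
    have e3 : 1 / 2 ≤ r ^ α :=
      calc (1 / 2 : ℝ) = (1 / 2) ^ (1 : ℝ) := by simp
        _ ≤ (1 / 2) ^ α := Real.rpow_le_rpow_of_exponent_ge (by norm_num) (by norm_num) hα.2.le
        _ ≤ r ^ α := Real.rpow_le_rpow (by norm_num) hbig hα0.le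
    calc |V (x, y) - V (x', y')| ≤ |V (x, y)| + |V (x', y')| := abs_sub _ _
      _ ≤ 4 * K * (1 / 2) := by linarith
      _ ≤ 4 * K * r ^ α := by gcongr
      _ ≤ _ := by
        have : 0 ≤ 6 * K / α * r ^ α := by positivity
        linarith
  rcases hr0.eq_or_lt with h0 | hpos
  · have : ((x, y) : Pt) = (x', y') := sub_eq_zero.1 (norm_eq_zero.1 (hr.symm.trans h0.symm))
    rw [this, sub_self, abs_zero]
    positivity
  obtain ⟨w, hw, hwy⟩ : ∃ w ∈ Icc r (1 - r), |w - y'| ≤ r := by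
    refine ⟨clamp r (1 - r) y', clamp_mem (by linarith) y', ?_⟩
    rcases le_total y' r with h1 | h1
    · rw [clamp_of_le h1, abs_le]
      constructor <;> linarith [hy'.1]
    rcases le_total y' (1 - r) with h2 | h2
    · rw [clamp_of_mem ⟨h1, h2⟩, sub_self, abs_zero]
      exact hr0
    · rw [clamp_of_ge (by linarith) h2, abs_le]
      constructor <;> linarith [hy'.2]
  have hw' : w ∈ Ioo (0 : ℝ) 1 := ⟨by linarith [hw.1], by linarith [hw.2]⟩
  have hwy2 : |y' - w| ≤ r := by rwa [abs_sub_comm]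
  have e1 := abs_sub_le_vertical hL hα hK hV h hx hy hy'
  have e2 := abs_sub_le_vertical hL hα hK hV h hx hy' hw'
  have e3 := abs_sub_le_vertical hL hα hK hV h hx' hw' hy'
  have e4 := abs_sub_le_horizontal hL hα hK hV h hx hx' hw'
  have m1 : ∀ u : ℝ, |u| ≤ r → 2 * K / α * |u| ^ α ≤ 2 * K / α * r ^ α := by
    intro u hu
    gcongr
  have m2 : K * (min w (1 - w)) ^ (α - 1) * |x - x'| ≤ K * r ^ α := by
    have hmin : r ≤ min w (1 - w) := le_min hw.1 (by linarith [hw.2])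
    have : (min w (1 - w)) ^ (α - 1) ≤ r ^ (α - 1) :=
      Real.rpow_le_rpow_of_nonpos hpos hmin (by linarith [hα.2])
    calc K * (min w (1 - w)) ^ (α - 1) * |x - x'| ≤ K * r ^ (α - 1) * r := by gcongr
      _ = K * r ^ α := by
        rw [mul_assoc, ← Real.rpow_add_one hpos.ne']
        simp
  have t1 := abs_sub_le (V (x, y)) (V (x, y')) (V (x', y'))
  have t2 := abs_sub_le (V (x, y')) (V (x, w)) (V (x', y'))
  have t3 := abs_sub_le (V (x, w)) (V (x', w)) (V (x', y'))
  have : (6 * K / α + 4 * K) * r ^ α =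
      2 * K / α * r ^ α + 2 * K / α * r ^ α + 2 * K / α * r ^ α + 4 * (K * r ^ α) := by ring
  have hKr : 0 ≤ K * r ^ α := by positivity
  linarith [m1 _ hr2, m1 _ hwy2, m1 _ hwy]


/-! ### The stream function -/

/-- the primitive of a continuous function bounded below by a positive constant has a
differentiable inverse -/
theorem exists_inverse_primitive {v : ℝ → ℝ} {ν : ℝ} (hν : 0 < ν) (hv : Continuous v)
    (hle : ∀ t, ν ≤ v t) :
    ∃ Q : ℝ → ℝ, (∀ t, Q (∫ s in (0 : ℝ)..t, v s) = t) ∧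
      (∀ s, ∫ r in (0 : ℝ)..Q s, v r = s) ∧ ∀ s, HasDerivAt Q (v (Q s))⁻¹ s := by
  let P : ℝ → ℝ := fun t => ∫ s in (0 : ℝ)..t, v s
  have hP : ∀ t, HasDerivAt P (v t) t := fun t => (hv.integral_hasStrictDerivAt 0 t).hasDerivAt
  have hPc : Continuous P := continuous_iff_continuousAt.2 fun t => (hP t).continuousAt
  have hmono : StrictMono P := strictMono_of_deriv_pos fun t => by
    rw [(hP t).deriv]
    exact hν.trans_le (hle t)
  have hP0 : P 0 = 0 := intervalIntegral.integral_same
  have hgrow : ∀ s t : ℝ, s ≤ t → ν * (t - s) ≤ P t - P s := fun s t hst =>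
    mul_sub_le_image_sub_of_le_deriv (fun t => (hP t).differentiableAt)
      (fun t => by rw [(hP t).deriv]; exact hle t) hst
  have hsurj : Function.Surjective P := by
    refine hPc.surjective ?_ ?_
    · refine Filter.tendsto_atTop_mono' _ ?_ (Filter.tendsto_id.const_mul_atTop hν)
      filter_upwards [Filter.eventually_ge_atTop 0] with t ht
      have := hgrow 0 t ht
      simp only [id]
      linarith
    · refine Filter.tendsto_atBot_mono' _ ?_ (Filter.tendsto_id.const_mul_atBot hν)
      filter_upwards [Filter.eventually_le_atBot 0] with t ht
      have := hgrow t 0 ht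
      simp only [id]
      linarith
  let e := hmono.orderIsoOfSurjective P hsurj
  have hr : ∀ s, P (e.symm s) = s := e.apply_symm_apply
  refine ⟨e.symm, e.symm_apply_apply, hr, fun s => ?_⟩
  exact HasDerivAt.of_local_left_inverse e.symm.continuous.continuousAt (hP _)
    (hν.trans_le (hle _)).ne' (Filter.Eventually.of_forall hr)

/-- constant extension of a function off the closed nozzle -/
def clampExt (L : ℝ) (V : Pt → ℝ) : Pt → ℝ := fun z => V (clamp 0 L z.1, clamp 0 1 z.2)

/-- the stream function of a divergence free field with first component `V` -/
def stream (L : ℝ) (V : Pt → ℝ) : Pt → ℝ := fun z => ∫ s in (0 : ℝ)..z.2, clampExt L V (z.1, s)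

theorem clampExt_of_mem {L : ℝ} {V : Pt → ℝ} {z : Pt} (hz : z ∈ Icc 0 L ×ˢ Icc (0 : ℝ) 1) :
    clampExt L V z = V z := by
  rw [clampExt, clamp_of_mem hz.1, clamp_of_mem hz.2]

theorem continuous_clampExt {L : ℝ} (hL : 0 < L) {V : Pt → ℝ}
    (hV : ContinuousOn V (closure (Noz L))) : Continuous (clampExt L V) := by
  rw [closure_Noz hL] at hV
  exact hV.comp_continuous (((continuous_clamp 0 L).comp continuous_fst).prodMk
    ((continuous_clamp 0 1).comp continuous_snd))
    fun z => ⟨clamp_mem hL.le _, clamp_mem zero_le_one _⟩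

/-- the hypotheses on the advecting field -/
structure IsNozzleFlow (L α K ν : ℝ) (V₁ V₂ : Pt → ℝ) : Prop where
  hL : 0 < L
  hα : α ∈ Ioo (0 : ℝ) 1
  hK : 0 ≤ K
  hν : 0 < ν
  cont₁ : ContinuousOn V₁ (closure (Noz L))
  cont₂ : ContinuousOn V₂ (closure (Noz L))
  diff₁ : DifferentiableOn ℝ V₁ (Noz L)
  diff₂ : DifferentiableOn ℝ V₂ (Noz L)
  div_free : ∀ x ∈ Noz L, pd1 V₁ x + pd2 V₂ x = 0
  slip : ∀ x ∈ GamW L, V₂ x = 0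
  bound₁ : whNorm 1 α (-α) (GamWbar L) (Noz L) V₁ ≤ ENNReal.ofReal K
  bound₂ : whNorm 1 α (-α) (GamWbar L) (Noz L) V₂ ≤ ENNReal.ofReal K
  lower : ∀ x ∈ closure (Noz L), ν ≤ V₁ x

namespace IsNozzleFlow

variable {L α K ν : ℝ} {V₁ V₂ : Pt → ℝ}

theorem abs_clampExt_le (hL : 0 < L) (hα : α ∈ Ioo (0 : ℝ) 1) (hK : 0 ≤ K) {V : Pt → ℝ}
    (hc : ContinuousOn V (closure (Noz L)))
    (hb : whNorm 1 α (-α) (GamWbar L) (Noz L) V ≤ ENNReal.ofReal K) (z : Pt) :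
    |clampExt L V z| ≤ K :=
  le_on_closure (fun _ hx => abs_le_of_whNorm_le hα hK hb hx) hc.abs continuousOn_const
    (by rw [closure_Noz hL]; exact ⟨clamp_mem hL.le _, clamp_mem zero_le_one _⟩)

theorem le_clampExt (h : IsNozzleFlow L α K ν V₁ V₂) (z : Pt) : ν ≤ clampExt L V₁ z :=
  h.lower _ (by rw [closure_Noz h.hL]; exact ⟨clamp_mem h.hL.le _, clamp_mem zero_le_one _⟩)

theorem slip_closed (h : IsNozzleFlow L α K ν V₁ V₂) {x y : ℝ} (hx : x ∈ Icc 0 L)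
    (hy : y = 0 ∨ y = 1) : V₂ (x, y) = 0 := by
  have hy' : y ∈ Icc (0 : ℝ) 1 := by rcases hy with rfl | rfl <;> simp
  have hc : ContinuousOn (fun t => V₂ (t, y)) (Icc 0 L) := by
    have := h.cont₂
    rw [closure_Noz h.hL] at this
    exact this.comp (by fun_prop) fun t ht => ⟨ht, hy'⟩
  have : EqOn (fun t => V₂ (t, y)) (fun _ => 0) (Icc 0 L) :=
    EqOn.of_subset_closure (s := Ioo 0 L) (fun t ht => h.slip (t, y) ⟨ht, by simpa using hy⟩) hc
      continuousOn_const Ioo_subset_Icc_self (closure_Ioo h.hL.ne).ge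
  exact this hx

theorem hasDerivAt_stream_snd (h : IsNozzleFlow L α K ν V₁ V₂) (x y : ℝ) :
    HasDerivAt (fun t => stream L V₁ (x, t)) (clampExt L V₁ (x, y)) y := by
  have hc : Continuous fun t => clampExt L V₁ (x, t) :=
    (continuous_clampExt h.hL h.cont₁).comp (by fun_prop)
  exact (hc.integral_hasStrictDerivAt 0 y).hasDerivAt

theorem stream_eq_sub_integral (h : IsNozzleFlow L α K ν V₁ V₂) {x y : ℝ} (hx : x ∈ Icc 0 L)
    (hy : y ∈ Icc (0 : ℝ) 1) :
    stream L V₁ (x, y) = stream L V₁ (0, y) - ∫ s in (0 : ℝ)..x, clampExt L V₂ (s, y) := by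
  classical
  have hsub : Ioo 0 x ×ˢ Ioo 0 y ⊆ Noz L := fun z hz =>
    ⟨⟨hz.1.1, hz.1.2.trans_le hx.2⟩, hz.2.1, hz.2.2.trans_le hy.2⟩
  have hloc : ∀ V : Pt → ℝ, DifferentiableOn ℝ V (Noz L) → ∀ z ∈ Noz L,
      HasFDerivAt (clampExt L V) (if z ∈ Noz L then fderiv ℝ V z else 0) z := by
    intro V hV z hz
    rw [if_pos hz]
    refine (hV.differentiableAt ((isOpen_Noz L).mem_nhds hz)).hasFDerivAt.congr_of_eventuallyEq ?_
    filter_upwards [(isOpen_Noz L).mem_nhds hz] with w hw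
    exact clampExt_of_mem ⟨Ioo_subset_Icc_self hw.1, Ioo_subset_Icc_self hw.2⟩
  have hdiv : ∀ z : Pt, (if z ∈ Noz L then fderiv ℝ V₁ z else 0) (1, 0) +
      (if z ∈ Noz L then fderiv ℝ V₂ z else 0) (0, 1) = 0 := by
    intro z
    by_cases hz : z ∈ Noz L
    · simp only [if_pos hz]
      exact h.div_free z hz
    · simp [if_neg hz]
  have key := integral2_divergence_prod_of_hasFDerivAt_off_countable (clampExt L V₁)
    (clampExt L V₂) (fun z => if z ∈ Noz L then fderiv ℝ V₁ z else 0)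
    (fun z => if z ∈ Noz L then fderiv ℝ V₂ z else 0) 0 0 x y ∅ countable_empty
    (continuous_clampExt h.hL h.cont₁).continuousOn (continuous_clampExt h.hL h.cont₂).continuousOn
    (by
      rw [min_eq_left hx.1, max_eq_right hx.1, min_eq_left hy.1, max_eq_right hy.1]
      exact fun z hz => hloc V₁ h.diff₁ z (hsub hz.1))
    (by
      rw [min_eq_left hx.1, max_eq_right hx.1, min_eq_left hy.1, max_eq_right hy.1]
      exact fun z hz => hloc V₂ h.diff₂ z (hsub hz.1))
    (by simp only [hdiv]; exact integrableOn_zero)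
  simp only [hdiv, intervalIntegral.integral_zero] at key
  have hwall : ∫ s in (0 : ℝ)..x, clampExt L V₂ (s, 0) = 0 := by
    refine intervalIntegral.integral_zero_ae (Filter.Eventually.of_forall fun s hs => ?_)
    rw [uIoc_of_le hx.1] at hs
    have hs' : s ∈ Icc 0 L := ⟨hs.1.le, hs.2.trans hx.2⟩
    rw [clampExt_of_mem ⟨hs', by simp⟩]
    exact h.slip_closed hs' (Or.inl rfl)
  simp only [stream]
  linarith

theorem stream_zero (x : ℝ) : stream L V₁ (x, 0) = 0 := intervalIntegral.integral_same

theorem stream_one (h : IsNozzleFlow L α K ν V₁ V₂) {x : ℝ} (hx : x ∈ Icc 0 L) :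
    stream L V₁ (x, 1) = stream L V₁ (0, 1) := by
  rw [h.stream_eq_sub_integral hx (by simp), sub_eq_self]
  refine intervalIntegral.integral_zero_ae (Filter.Eventually.of_forall fun s hs => ?_)
  rw [uIoc_of_le hx.1] at hs
  have hs' : s ∈ Icc 0 L := ⟨hs.1.le, hs.2.trans hx.2⟩
  rw [clampExt_of_mem ⟨hs', by simp⟩]
  exact h.slip_closed hs' (Or.inr rfl)

theorem hasDerivWithinAt_stream_fst (h : IsNozzleFlow L α K ν V₁ V₂) {x y : ℝ}
    (hx : x ∈ Icc 0 L) (hy : y ∈ Icc (0 : ℝ) 1) :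
    HasDerivWithinAt (fun t => stream L V₁ (t, y)) (-V₂ (x, y)) (Icc 0 L) x := by
  have hc : Continuous fun t => clampExt L V₂ (t, y) :=
    (continuous_clampExt h.hL h.cont₂).comp (by fun_prop)
  have := ((hc.integral_hasStrictDerivAt 0 x).hasDerivAt.const_sub
    (stream L V₁ (0, y))).hasDerivWithinAt (s := Icc 0 L)
  rw [clampExt_of_mem ⟨hx, hy⟩] at this
  exact this.congr (fun t ht => h.stream_eq_sub_integral ht hy) (h.stream_eq_sub_integral hx hy)

theorem hasDerivWithinAt_stream_snd (h : IsNozzleFlow L α K ν V₁ V₂) {x y : ℝ}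
    (hx : x ∈ Icc 0 L) (hy : y ∈ Icc (0 : ℝ) 1) :
    HasDerivWithinAt (fun t => stream L V₁ (x, t)) (V₁ (x, y)) (Icc 0 1) y := by
  have := (h.hasDerivAt_stream_snd x y).hasDerivWithinAt (s := Icc 0 1)
  rwa [clampExt_of_mem ⟨hx, hy⟩] at this

theorem hasFDerivAt_stream (h : IsNozzleFlow L α K ν V₁ V₂) {z : Pt} (hz : z ∈ Noz L) :
    HasFDerivAt (stream L V₁) (gradCLM (-V₂ z) (V₁ z)) z :=
  (hasFDerivAt_and_contDiffOn_of_partials (isOpen_Noz L)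
    (fun _ hw => (h.hasDerivWithinAt_stream_fst (Ioo_subset_Icc_self hw.1)
      (Ioo_subset_Icc_self hw.2)).hasDerivAt (Icc_mem_nhds hw.1.1 hw.1.2))
    (fun _ hw => (h.hasDerivWithinAt_stream_snd (Ioo_subset_Icc_self hw.1)
      (Ioo_subset_Icc_self hw.2)).hasDerivAt (Icc_mem_nhds hw.2.1 hw.2.2))
    (h.cont₂.neg.mono subset_closure) (h.cont₁.mono subset_closure)).1 z hz

theorem mul_abs_sub_le_stream (h : IsNozzleFlow L α K ν V₁ V₂) (x s t : ℝ) :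
    ν * |s - t| ≤ |stream L V₁ (x, s) - stream L V₁ (x, t)| := by
  wlog hst : t ≤ s generalizing s t
  · rw [abs_sub_comm, abs_sub_comm (stream _ _ _)]
    exact this t s (le_of_not_ge hst)
  rw [abs_of_nonneg (sub_nonneg.2 hst)]
  refine le_trans ?_ (le_abs_self _)
  exact mul_sub_le_image_sub_of_le_deriv (f := fun u => stream L V₁ (x, u))
    (fun u => (h.hasDerivAt_stream_snd x u).differentiableAt)
    (fun u => by rw [(h.hasDerivAt_stream_snd x u).deriv]; exact h.le_clampExt _) hst

theorem strictMono_stream (h : IsNozzleFlow L α K ν V₁ V₂) (x : ℝ) :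
    StrictMono fun t => stream L V₁ (x, t) :=
  strictMono_of_deriv_pos fun t => by
    rw [(h.hasDerivAt_stream_snd x t).deriv]
    exact h.hν.trans_le (h.le_clampExt _)

theorem abs_stream_sub_fst_le (h : IsNozzleFlow L α K ν V₁ V₂) {x x' y : ℝ} (hx : x ∈ Icc 0 L)
    (hx' : x' ∈ Icc 0 L) (hy : y ∈ Icc (0 : ℝ) 1) :
    |stream L V₁ (x, y) - stream L V₁ (x', y)| ≤ K * |x - x'| :=
  Convex.norm_image_sub_le_of_norm_hasDerivWithin_le (f := fun u => stream L V₁ (u, y))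
    (fun _ hu => h.hasDerivWithinAt_stream_fst hu hy)
    (fun u hu => by
      rw [norm_neg, ← clampExt_of_mem (V := V₂) (L := L) (z := (u, y)) ⟨hu, hy⟩]
      exact abs_clampExt_le h.hL h.hα h.hK h.cont₂ h.bound₂ _)
    (convex_Icc 0 L) hx' hx

theorem abs_stream_sub_snd_le (h : IsNozzleFlow L α K ν V₁ V₂) (x s t : ℝ) :
    |stream L V₁ (x, s) - stream L V₁ (x, t)| ≤ K * |s - t| :=
  Convex.norm_image_sub_le_of_norm_hasDerivWithin_le (f := fun u => stream L V₁ (x, u))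
    (fun u _ => (h.hasDerivAt_stream_snd x u).hasDerivWithinAt)
    (fun _ _ => abs_clampExt_le h.hL h.hα h.hK h.cont₁ h.bound₁ _)
    convex_univ (mem_univ _) (mem_univ _)

theorem abs_stream_sub_le (h : IsNozzleFlow L α K ν V₁ V₂) {p q : Pt} (hp : p ∈ Noz L)
    (hq : q ∈ Noz L) : |stream L V₁ p - stream L V₁ q| ≤ 2 * K * ‖p - q‖ := by
  have h1 := h.abs_stream_sub_fst_le (Ioo_subset_Icc_self hp.1) (Ioo_subset_Icc_self hq.1)
    (Ioo_subset_Icc_self hp.2)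
  have h2 := h.abs_stream_sub_snd_le q.1 p.2 q.2
  have h3 := abs_sub_le (stream L V₁ p) (stream L V₁ (q.1, p.2)) (stream L V₁ q)
  have h4 := mul_le_mul_of_nonneg_left (norm_fst_le (p - q)) h.hK
  have h5 := mul_le_mul_of_nonneg_left (norm_snd_le (p - q)) h.hK
  simp only [Prod.fst_sub, Prod.snd_sub, Real.norm_eq_abs] at h4 h5
  simp only [Prod.mk.eta] at h1 h2
  linarith

open Filter Topology Asymptotics in
/-- A function transported by the flow is constant along the level sets of the stream function. -/
theorem eq_of_stream_eq (h : IsNozzleFlow L α K ν V₁ V₂) {W : Pt → ℝ}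
    (hW : ContinuousOn W (closure (Noz L))) (hWd : DifferentiableOn ℝ W (Noz L))
    (htr : ∀ x ∈ Noz L, V₁ x * pd1 W x + V₂ x * pd2 W x = 0) {z : Pt} (hz : z ∈ Noz L) {y₀ : ℝ}
    (hy₀ : stream L V₁ (0, y₀) = stream L V₁ z) : W z = W (0, y₀) := by
  have hex : ∀ x, ∃ y, stream L V₁ (x, y) = stream L V₁ z := by
    intro x
    obtain ⟨Q, -, hQ, -⟩ := exists_inverse_primitive h.hν
      (v := fun t => clampExt L V₁ (x, t))
      ((continuous_clampExt h.hL h.cont₁).comp (by fun_prop)) (fun t => h.le_clampExt _)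
    exact ⟨Q _, hQ _⟩
  choose η hη using hex
  have hzIcc := Ioo_subset_Icc_self hz.1
  have hηmem : ∀ x ∈ Icc 0 L, η x ∈ Ioo (0 : ℝ) 1 := by
    intro x hx
    constructor
    · rw [← (h.strictMono_stream x).lt_iff_lt]
      simp only [hη, stream_zero]
      rw [← stream_zero (L := L) (V₁ := V₁) z.1]
      exact h.strictMono_stream z.1 hz.2.1
    · rw [← (h.strictMono_stream x).lt_iff_lt]
      simp only [hη, h.stream_one hx]
      rw [← h.stream_one hzIcc]
      exact h.strictMono_stream z.1 hz.2.2
  have hηlip : ∀ x ∈ Icc 0 L, ∀ x' ∈ Icc 0 L, |η x - η x'| ≤ K / ν * |x - x'| := by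
    intro x hx x' hx'
    have h1 := h.mul_abs_sub_le_stream x (η x) (η x')
    rw [hη x, ← hη x'] at h1
    have h2 := h.abs_stream_sub_fst_le hx' hx (Ioo_subset_Icc_self (hηmem x' hx'))
    rw [abs_sub_comm x' x] at h2
    rw [div_mul_eq_mul_div, le_div_iff₀ h.hν]
    linarith
  have hηcont : ContinuousOn η (Icc 0 L) :=
    (LipschitzOnWith.of_dist_le_mul (K := ⟨K / ν, div_nonneg h.hK h.hν.le⟩) hηlip).continuousOn
  have hγcont : ContinuousOn (fun t => ((t, η t) : Pt)) (Icc 0 L) :=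
    continuousOn_id.prodMk hηcont
  have hγmem : MapsTo (fun t => ((t, η t) : Pt)) (Icc 0 L) (closure (Noz L)) := by
    rw [closure_Noz h.hL]
    exact fun t ht => ⟨ht, Ioo_subset_Icc_self (hηmem t ht)⟩
  have hderiv : ∀ x ∈ Ioo 0 L, HasDerivAt (fun t => W (t, η t)) 0 x := by
    intro x hx
    have hnhds : Icc 0 L ∈ 𝓝 x := Icc_mem_nhds hx.1 hx.2
    have hp : ((x, η x) : Pt) ∈ Noz L := ⟨hx, hηmem x (Ioo_subset_Icc_self hx)⟩
    have hV : V₁ (x, η x) ≠ 0 := (h.hν.trans_le (h.lower _ (subset_closure hp))).ne'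
    set c := pd2 W (x, η x) / V₁ (x, η x) with hc
    have hWp : HasFDerivAt W (gradCLM (pd1 W (x, η x)) (pd2 W (x, η x))) (x, η x) := by
      refine (hWd.differentiableAt ((isOpen_Noz L).mem_nhds hp)).hasFDerivAt.congr_fderiv ?_
      ext <;> simp [gradCLM, pd1, pd2]
    have hG : HasFDerivAt (fun q => W q - c * stream L V₁ q) (0 : Pt →L[ℝ] ℝ) (x, η x) := by
      refine (hWp.sub ((h.hasFDerivAt_stream hp).const_mul c)).congr_fderiv ?_
      have e1 : pd1 W (x, η x) + c * V₂ (x, η x) = 0 := by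
        have := htr _ hp
        rw [hc]
        field_simp
        linarith
      have e2 : pd2 W (x, η x) - c * V₁ (x, η x) = 0 := by
        rw [hc]
        field_simp
        ring
      ext
      · simpa [gradCLM] using e1
      · simpa [gradCLM] using e2
    have hlittle := (hasFDerivAt_iff_isLittleO.1 hG).comp_tendsto (hγcont.continuousAt hnhds)
    have hbig : (fun t => ((t, η t) : Pt) - (x, η x)) =O[𝓝 x] fun t => t - x := by
      refine IsBigO.of_bound (max 1 (K / ν)) ?_
      filter_upwards [hnhds] with t ht
      rw [Prod.norm_def]
      refine max_le ?_ ?_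
      · exact le_mul_of_one_le_left (norm_nonneg _) (le_max_left _ _)
      · refine (hηlip t ht x (Ioo_subset_Icc_self hx)).trans ?_
        exact mul_le_mul_of_nonneg_right (le_max_right _ _) (abs_nonneg _)
    rw [hasDerivAt_iff_isLittleO]
    refine (hlittle.trans_isBigO hbig).congr' ?_ EventuallyEq.rfl
    refine Eventually.of_forall fun t => ?_
    simp [hη]
  obtain ⟨x, hx, hslope⟩ := exists_hasDerivAt_eq_slope (fun t => W (t, η t)) (fun _ => 0) hz.1.1
    ((hW.comp hγcont hγmem).mono (Icc_subset_Icc_right hzIcc.2))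
    (fun t ht => hderiv t ⟨ht.1, ht.2.trans hz.1.2⟩)
  have hz1 : z.1 - 0 ≠ 0 := by simpa using hz.1.1.ne'
  rw [eq_comm, div_eq_zero_iff, or_iff_left hz1, sub_eq_zero] at hslope
  have e1 : η z.1 = z.2 := (h.strictMono_stream z.1).injective (hη z.1)
  have e2 : η 0 = y₀ := (h.strictMono_stream 0).injective ((hη 0).trans hy₀.symm)
  rwa [e1, e2] at hslope

/-- The map sending a point to the height at which its streamline enters the nozzle. -/
theorem exists_entrance_map (h : IsNozzleFlow L α K ν V₁ V₂) :
    ∃ (Y : Pt → ℝ) (U : Set Pt), IsOpen U ∧ closure (Noz L) ⊆ U ∧ ContDiffOn ℝ 1 Y U ∧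
      (∀ t ∈ Icc (0 : ℝ) 1, Y (0, t) = t) ∧ (∀ z ∈ Noz L, Y z ∈ Ioo (0 : ℝ) 1) ∧
      (∀ z ∈ Noz L, HasFDerivAt Y (gradCLM (-V₂ z / V₁ (0, Y z)) (V₁ z / V₁ (0, Y z))) z) ∧
      (∀ z ∈ Noz L, stream L V₁ (0, Y z) = stream L V₁ z) ∧
      ∀ p ∈ Noz L, ∀ q ∈ Noz L, |Y p - Y q| ≤ 2 * K / ν * ‖p - q‖ := by
  have hR := closure_Noz h.hL
  obtain ⟨Ψ, U, hU, hRU, hΨ, hΨc, hΨd⟩ := exists_contDiffOn_extension h.hL zero_lt_one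
    (f := stream L V₁) (g₁ := fun z => -V₂ z) (g₂ := V₁)
    (fun _ hz => h.hasDerivWithinAt_stream_fst hz.1 hz.2)
    (fun _ hz => h.hasDerivWithinAt_stream_snd hz.1 hz.2)
    (hR ▸ h.cont₂.neg) (hR ▸ h.cont₁)
  have hv : Continuous fun t => clampExt L V₁ (0, t) :=
    (continuous_clampExt h.hL h.cont₁).comp (by fun_prop)
  obtain ⟨Q, hQl, hQr, hQd⟩ := exists_inverse_primitive h.hν hv (fun t => h.le_clampExt _)
  have hsub : Noz L ⊆ Icc 0 L ×ˢ Icc 0 1 := hR ▸ subset_closure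
  have hstream : ∀ z ∈ Noz L, stream L V₁ (0, Q (Ψ z)) = stream L V₁ z := by
    intro z hz
    rw [← hΨ (hsub hz)]
    exact hQr _
  have hmem : ∀ z ∈ Noz L, Q (Ψ z) ∈ Ioo (0 : ℝ) 1 := by
    intro z hz
    constructor
    · rw [← (h.strictMono_stream 0).lt_iff_lt]
      simp only [hstream z hz, stream_zero]
      rw [← stream_zero (L := L) (V₁ := V₁) z.1]
      exact h.strictMono_stream z.1 hz.2.1
    · rw [← (h.strictMono_stream 0).lt_iff_lt]
      simp only [hstream z hz]
      rw [← h.stream_one (hsub hz).1]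
      exact h.strictMono_stream z.1 hz.2.2
  have hQc : ContDiff ℝ 1 Q := by
    rw [contDiff_one_iff_deriv]
    refine ⟨fun s => (hQd s).differentiableAt, ?_⟩
    have hQcont : Continuous Q := continuous_iff_continuousAt.2 fun s => (hQd s).continuousAt
    rw [funext fun s => (hQd s).deriv]
    exact (hv.comp hQcont).inv₀ fun s => (h.hν.trans_le (h.le_clampExt _)).ne'
  refine ⟨fun z => Q (Ψ z), U, hU, hR ▸ hRU, hQc.comp_contDiffOn hΨc, ?_, hmem, ?_, hstream, ?_⟩
  · intro t ht
    simp only [hΨ (show ((0, t) : Pt) ∈ Icc 0 L ×ˢ Icc 0 1 from ⟨⟨le_rfl, h.hL.le⟩, ht⟩)]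
    exact hQl t
  · intro z hz
    have h0 : ((0, Q (Ψ z)) : Pt) ∈ Icc 0 L ×ˢ Icc 0 1 :=
      ⟨⟨le_rfl, h.hL.le⟩, Ioo_subset_Icc_self (hmem z hz)⟩
    have h1 := (hQd (Ψ z)).comp_hasFDerivAt z (hΨd z (hsub hz))
    rw [clampExt_of_mem h0] at h1
    refine h1.congr_fderiv ?_
    ext <;> simp [gradCLM] <;> ring
  · intro p hp q hq
    have h1 := h.mul_abs_sub_le_stream 0 (Q (Ψ p)) (Q (Ψ q))
    rw [hstream p hp, hstream q hq] at h1
    have h2 := h.abs_stream_sub_le hp hq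
    rw [div_mul_eq_mul_div, le_div_iff₀ h.hν]
    linarith

open Filter Topology in
/-- Hölder continuity of the entrance profile of the horizontal velocity. -/
theorem abs_entrance_sub_le (h : IsNozzleFlow L α K ν V₁ V₂) {s t : ℝ}
    (hs : s ∈ Ioo (0 : ℝ) 1) (ht : t ∈ Ioo (0 : ℝ) 1) :
    |V₁ (0, s) - V₁ (0, t)| ≤ 2 * K / α * |s - t| ^ α := by
  have hc : ∀ u ∈ Ioo (0 : ℝ) 1, ContinuousOn (fun x => V₁ (x, u)) (closure (Ioo 0 L)) := by
    intro u hu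
    have := h.cont₁
    rw [closure_Noz h.hL] at this
    rw [closure_Ioo h.hL.ne]
    exact this.comp (by fun_prop) fun x hx => ⟨hx, Ioo_subset_Icc_self hu⟩
  exact le_on_closure (s := Ioo 0 L) (f := fun x => |V₁ (x, s) - V₁ (x, t)|)
    (fun x hx => abs_sub_le_vertical h.hL h.hα h.hK h.diff₁ h.bound₁ hx hs ht)
    ((hc s hs).sub (hc t ht)).abs continuousOn_const
    (by rw [closure_Ioo h.hL.ne]; exact ⟨le_rfl, h.hL.le⟩)

end IsNozzleFlow

/-! ### The transport problem for a scalar -/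

theorem exists_contDiff_extension_Icc {f : ℝ → ℝ} (hf : ContDiffOn ℝ 1 f (Icc 0 1)) :
    ∃ F : ℝ → ℝ, ContDiff ℝ 1 F ∧ EqOn F f (Icc 0 1) := by
  have hc : ContinuousOn (derivWithin f (Icc 0 1)) (Icc 0 1) :=
    hf.continuousOn_derivWithin (uniqueDiffOn_Icc zero_lt_one) le_rfl
  let w : ℝ → ℝ := fun t => derivWithin f (Icc 0 1) (clamp 0 1 t)
  have hw : Continuous w :=
    hc.comp_continuous (continuous_clamp 0 1) fun t => clamp_mem zero_le_one t
  have hF : ∀ t, HasDerivAt (fun t => f 0 + ∫ s in (0 : ℝ)..t, w s) (w t) t := fun t =>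
    (hw.integral_hasStrictDerivAt 0 t).hasDerivAt.const_add (f 0)
  refine ⟨fun t => f 0 + ∫ s in (0 : ℝ)..t, w s, ?_, ?_⟩
  · rw [contDiff_one_iff_deriv]
    refine ⟨fun t => (hF t).differentiableAt, ?_⟩
    rwa [funext fun t => (hF t).deriv]
  · intro t ht
    have := intervalIntegral.integral_eq_sub_of_hasDerivAt_of_le (f := f) (f' := w) ht.1
      (hf.continuousOn.mono (Icc_subset_Icc_right ht.2)) (fun s hs => by
        have hs' : s ∈ Ioo (0 : ℝ) 1 := ⟨hs.1, hs.2.trans_le ht.2⟩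
        have h1 := ((hf.differentiableOn one_ne_zero) s
          (Ioo_subset_Icc_self hs')).hasDerivWithinAt.hasDerivAt (Icc_mem_nhds hs'.1 hs'.2)
        simpa only [w, clamp_of_mem (Ioo_subset_Icc_self hs')] using h1)
      (hw.intervalIntegrable 0 t)
    simp only [this]
    ring

theorem supAbs_le {Ω : Set Pt} {g : Pt → ℝ} {B : ℝ} (h : ∀ z ∈ Ω, |g z| ≤ B) :
    supAbs Ω g ≤ ENNReal.ofReal B :=
  iSup₂_le fun z hz => ENNReal.ofReal_le_ofReal (h z hz)

theorem hSemi_le {Ω : Set Pt} {g : Pt → ℝ} {α B : ℝ}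
    (h : ∀ p ∈ Ω, ∀ q ∈ Ω, |g p - g q| ≤ B * ‖p - q‖ ^ α) : hSemi α Ω g ≤ ENNReal.ofReal B :=
  iSup₂_le fun p hp => iSup₂_le fun q hq => iSup_le fun hpq => ENNReal.ofReal_le_ofReal
    ((div_le_iff₀ (Real.rpow_pos_of_pos (norm_pos_iff.2 (sub_ne_zero.2 hpq)) α)).2 (h p hp q hq))

theorem hNorm_one_le {α A B H : ℝ} (hA : 0 ≤ A) (hB : 0 ≤ B) (hH : 0 ≤ H) {Ω : Set Pt}
    {f : Pt → ℝ} (h₀ : ∀ z ∈ Ω, |f z| ≤ A)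
    (h₁ : ∀ z ∈ Ω, |pd1 f z| ≤ B) (h₂ : ∀ z ∈ Ω, |pd2 f z| ≤ B)
    (h₃ : ∀ p ∈ Ω, ∀ q ∈ Ω, |pd1 f p - pd1 f q| ≤ H * ‖p - q‖ ^ α)
    (h₄ : ∀ p ∈ Ω, ∀ q ∈ Ω, |pd2 f p - pd2 f q| ≤ H * ‖p - q‖ ^ α) :
    hNorm 1 α Ω f ≤ ENNReal.ofReal (A + 2 * B + 2 * H) := by
  have e : ENNReal.ofReal (A + 2 * B + 2 * H) = (ENNReal.ofReal A + (ENNReal.ofReal B +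
      ENNReal.ofReal B)) + (ENNReal.ofReal H + ENNReal.ofReal H) := by
    rw [← ENNReal.ofReal_add hB hB, ← ENNReal.ofReal_add hH hH, ← ENNReal.ofReal_add hA (by linarith),
      ← ENNReal.ofReal_add (by linarith) (by linarith)]
    ring_nf
  rw [e, hNorm, idxLe_one, idxEq_one, Finset.sum_insert (by decide), Finset.sum_pair (by decide),
    Finset.sum_pair (by decide)]
  exact add_le_add (add_le_add (supAbs_le h₀) (add_le_add (supAbs_le h₂) (supAbs_le h₁)))
    (add_le_add (hSemi_le h₄) (hSemi_le h₃))

theorem h1Norm_one (α : ℝ) (Ω : Set ℝ) (f : ℝ → ℝ) :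
    h1Norm 1 α Ω f = supAbs1 Ω f + supAbs1 Ω (deriv f) + hSemi1 α Ω (deriv f) := by
  simp [h1Norm, Finset.sum_range_succ]

theorem abs_le_of_supAbs1_le {Ω : Set ℝ} {g : ℝ → ℝ} {B : ℝ} (hB : 0 ≤ B)
    (h : supAbs1 Ω g ≤ ENNReal.ofReal B) {t : ℝ} (ht : t ∈ Ω) : |g t| ≤ B :=
  (ENNReal.ofReal_le_ofReal_iff hB).1 ((le_iSup₂_of_le (f := fun x (_ : x ∈ Ω) =>
    ENNReal.ofReal |g x|) t ht le_rfl).trans h)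

theorem abs_sub_le_of_hSemi1_le {Ω : Set ℝ} {g : ℝ → ℝ} {α B : ℝ} (hB : 0 ≤ B)
    (h : hSemi1 α Ω g ≤ ENNReal.ofReal B) {s t : ℝ} (hs : s ∈ Ω) (ht : t ∈ Ω) :
    |g s - g t| ≤ B * |s - t| ^ α := by
  by_cases hst : s = t
  · rw [hst, sub_self, abs_zero]
    exact mul_nonneg hB (Real.rpow_nonneg (abs_nonneg _) _)
  have h1 : ENNReal.ofReal (|g s - g t| / |s - t| ^ α) ≤ hSemi1 α Ω g :=
    le_iSup₂_of_le s hs (le_iSup₂_of_le t ht (le_iSup_of_le hst le_rfl))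
  rw [← div_le_iff₀ (Real.rpow_pos_of_pos (abs_pos.2 (sub_ne_zero.2 hst)) α)]
  exact (ENNReal.ofReal_le_ofReal_iff hB).1 (h1.trans h)

theorem abs_mul_mul_sub_le {a b c a' b' c' A B C A' B' C' : ℝ} (hA : 0 ≤ A) (hB : 0 ≤ B)
    (ha' : |a'| ≤ A) (hb : |b| ≤ B) (hb' : |b'| ≤ B) (hc : |c| ≤ C)
    (hda : |a - a'| ≤ A') (hdb : |b - b'| ≤ B') (hdc : |c - c'| ≤ C') :
    |a * b * c - a' * b' * c'| ≤ A' * B * C + A * B' * C + A * B * C' := by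
  have e : a * b * c - a' * b' * c' =
      (a - a') * b * c + a' * (b - b') * c + a' * b' * (c - c') := by ring
  have hA' : 0 ≤ A' := (abs_nonneg _).trans hda
  have hB' : 0 ≤ B' := (abs_nonneg _).trans hdb
  rw [e]
  refine (abs_add_three _ _ _).trans ?_
  simp only [abs_mul]
  gcongr

/-- Hölder constant of the gradient of the transported quantity -/
def gradHolderConst (α K ν : ℝ) : ℝ :=
  (2 * K / ν) ^ α * K * ν⁻¹ + (6 * K / α + 4 * K) * ν⁻¹ +
    K * (2 * K / α * (2 * K / ν) ^ α * (ν⁻¹ * ν⁻¹))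

/-- the constant in the transport estimate -/
def transportConst (α K ν : ℝ) : ℝ := 1 + 2 * (K * ν⁻¹) + 2 * gradHolderConst α K ν

theorem gradHolderConst_nonneg {α K ν : ℝ} (hα : 0 < α) (hK : 0 ≤ K) (hν : 0 < ν) :
    0 ≤ gradHolderConst α K ν := by
  unfold gradHolderConst
  positivity

theorem transportConst_pos {α K ν : ℝ} (hα : 0 < α) (hK : 0 ≤ K) (hν : 0 < ν) :
    0 < transportConst α K ν := by
  have := gradHolderConst_nonneg hα hK hν
  unfold transportConst
  positivity

theorem IsNozzleFlow.exists_transport_solution {L α K ν : ℝ} {V₁ V₂ : Pt → ℝ}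
    (h : IsNozzleFlow L α K ν V₁ V₂) {Wen : ℝ → ℝ} (hWen : ContDiffOn ℝ 1 Wen (Icc 0 1)) (W₀ : ℝ) :
    ∃ W : Pt → ℝ, TranSol L V₁ V₂ Wen W ∧
      hNorm 1 α (Noz L) (fun x => W x - W₀) ≤
        ENNReal.ofReal (transportConst α K ν) * h1Norm 1 α (Icc 0 1) (fun t => Wen t - W₀) ∧
      ∀ W', TranSol L V₁ V₂ Wen W' → EqOn W W' (closure (Noz L)) := by
  obtain ⟨Y, U, hU, hNU, hYc, hY0, hYmem, hYd, hYs, hYlip⟩ := h.exists_entrance_map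
  obtain ⟨E, hEc, hE⟩ := exists_contDiff_extension_Icc hWen
  have hderiv : ∀ t ∈ Ioo (0 : ℝ) 1, deriv E t = deriv Wen t := by
    intro t ht
    refine Filter.EventuallyEq.deriv_eq ?_
    filter_upwards [Icc_mem_nhds ht.1 ht.2] with s hs using hE hs
  have hent : ∀ z ∈ Noz L, ν ≤ V₁ (0, Y z) := by
    intro z hz
    refine h.lower _ ?_
    rw [closure_Noz h.hL]
    exact ⟨⟨le_rfl, h.hL.le⟩, Ioo_subset_Icc_self (hYmem z hz)⟩
  have hWd : ∀ c, ∀ z ∈ Noz L, HasFDerivAt (fun z => E (Y z) - c)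
      (deriv Wen (Y z) • gradCLM (-V₂ z / V₁ (0, Y z)) (V₁ z / V₁ (0, Y z))) z := by
    intro c z hz
    rw [← hderiv _ (hYmem z hz)]
    exact ((hEc.differentiable one_ne_zero (Y z)).hasDerivAt.comp_hasFDerivAt z
      (hYd z hz)).sub_const c
  have hpd1 : ∀ c, ∀ z ∈ Noz L, pd1 (fun z => E (Y z) - c) z =
      deriv Wen (Y z) * (-V₂ z) * (V₁ (0, Y z))⁻¹ := by
    intro c z hz
    rw [pd1, (hWd c z hz).fderiv]
    simp only [smul_apply, gradCLM_apply, smul_eq_mul]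
    ring
  have hpd2 : ∀ c, ∀ z ∈ Noz L, pd2 (fun z => E (Y z) - c) z =
      deriv Wen (Y z) * V₁ z * (V₁ (0, Y z))⁻¹ := by
    intro c z hz
    rw [pd2, (hWd c z hz).fderiv]
    simp only [smul_apply, gradCLM_apply, smul_eq_mul]
    ring
  have hWc : ContDiffOn ℝ 1 (fun z => E (Y z)) U := hEc.comp_contDiffOn hYc
  refine ⟨fun z => E (Y z), ⟨⟨U, hU, hNU, hWc⟩, ?_, ?_⟩, ?_, ?_⟩
  · intro z hz
    have e1 := hpd1 0 z hz
    have e2 := hpd2 0 z hz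
    simp only [sub_zero] at e1 e2
    rw [e1, e2]
    ring
  · intro t ht
    simp only [hY0 t ht, hE ht]
  · by_cases htop : h1Norm 1 α (Icc 0 1) (fun t => Wen t - W₀) = ⊤
    · rw [htop, ENNReal.mul_top
        (ENNReal.ofReal_pos.2 (transportConst_pos h.hα.1 h.hK h.hν)).ne']
      exact le_top
    set A := (h1Norm 1 α (Icc 0 1) (fun t => Wen t - W₀)).toReal
    have hA : 0 ≤ A := ENNReal.toReal_nonneg
    have hAeq : h1Norm 1 α (Icc 0 1) (fun t => Wen t - W₀) = ENNReal.ofReal A :=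
      (ENNReal.ofReal_toReal htop).symm
    have hder : deriv (fun t => Wen t - W₀) = deriv Wen := funext fun t => deriv_sub_const W₀
    have hle := hAeq.le
    rw [h1Norm_one, hder] at hle
    have b0 : ∀ t ∈ Icc (0 : ℝ) 1, |Wen t - W₀| ≤ A := fun t ht =>
      abs_le_of_supAbs1_le hA ((le_self_add.trans le_self_add).trans hle) ht
    have b1 : ∀ t ∈ Icc (0 : ℝ) 1, |deriv Wen t| ≤ A := fun t ht =>
      abs_le_of_supAbs1_le hA ((le_add_self.trans le_self_add).trans hle) ht
    have b2 : ∀ s ∈ Icc (0 : ℝ) 1, ∀ t ∈ Icc (0 : ℝ) 1,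
        |deriv Wen s - deriv Wen t| ≤ A * |s - t| ^ α := fun s hs t ht =>
      abs_sub_le_of_hSemi1_le hA (le_add_self.trans hle) hs ht
    have hν := h.hν
    have hK := h.hK
    have hα := h.hα.1
    have hYI : ∀ z ∈ Noz L, Y z ∈ Icc (0 : ℝ) 1 := fun z hz => Ioo_subset_Icc_self (hYmem z hz)
    have hYα : ∀ p ∈ Noz L, ∀ q ∈ Noz L,
        |Y p - Y q| ^ α ≤ (2 * K / ν) ^ α * ‖p - q‖ ^ α := by
      intro p hp q hq
      rw [← Real.mul_rpow (by positivity) (norm_nonneg _)]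
      exact Real.rpow_le_rpow (abs_nonneg _) (hYlip p hp q hq) hα.le
    have hinv : ∀ z ∈ Noz L, |(V₁ (0, Y z))⁻¹| ≤ ν⁻¹ := by
      intro z hz
      rw [abs_inv, abs_of_pos (hν.trans_le (hent z hz))]
      exact inv_anti₀ hν (hent z hz)
    have hinvH : ∀ p ∈ Noz L, ∀ q ∈ Noz L, |(V₁ (0, Y p))⁻¹ - (V₁ (0, Y q))⁻¹| ≤
        2 * K / α * (2 * K / ν) ^ α * (ν⁻¹ * ν⁻¹) * ‖p - q‖ ^ α := by
      intro p hp q hq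
      have hp0 := (hν.trans_le (hent p hp)).ne'
      have hq0 := (hν.trans_le (hent q hq)).ne'
      have e : (V₁ (0, Y p))⁻¹ - (V₁ (0, Y q))⁻¹ =
          (V₁ (0, Y q) - V₁ (0, Y p)) * ((V₁ (0, Y p))⁻¹ * (V₁ (0, Y q))⁻¹) := by
        field_simp
      rw [e, abs_mul, abs_mul, abs_sub_comm]
      calc _ ≤ 2 * K / α * ((2 * K / ν) ^ α * ‖p - q‖ ^ α) * (ν⁻¹ * ν⁻¹) := by
            gcongr
            · exact (h.abs_entrance_sub_le (hYmem p hp) (hYmem q hq)).trans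
                (mul_le_mul_of_nonneg_left (hYα p hp q hq) (by positivity))
            · exact hinv p hp
            · exact hinv q hq
        _ = _ := by ring
    have hwH : ∀ p ∈ Noz L, ∀ q ∈ Noz L, |deriv Wen (Y p) - deriv Wen (Y q)| ≤
        A * ((2 * K / ν) ^ α * ‖p - q‖ ^ α) := fun p hp q hq =>
      (b2 _ (hYI p hp) _ (hYI q hq)).trans (mul_le_mul_of_nonneg_left (hYα p hp q hq) hA)
    have hsup : ∀ V : Pt → ℝ, (∀ z ∈ Noz L, |V z| ≤ K) → ∀ z ∈ Noz L,
        |deriv Wen (Y z) * V z * (V₁ (0, Y z))⁻¹| ≤ A * (K * ν⁻¹) := by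
      intro V hV z hz
      rw [abs_mul, abs_mul, mul_assoc]
      gcongr
      · exact b1 _ (hYI z hz)
      · exact hV z hz
      · exact hinv z hz
    have hhol : ∀ V : Pt → ℝ, (∀ z ∈ Noz L, |V z| ≤ K) →
        (∀ p ∈ Noz L, ∀ q ∈ Noz L, |V p - V q| ≤ (6 * K / α + 4 * K) * ‖p - q‖ ^ α) →
        ∀ p ∈ Noz L, ∀ q ∈ Noz L,
        |deriv Wen (Y p) * V p * (V₁ (0, Y p))⁻¹ - deriv Wen (Y q) * V q * (V₁ (0, Y q))⁻¹| ≤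
          A * gradHolderConst α K ν * ‖p - q‖ ^ α := by
      intro V hV hVH p hp q hq
      refine (abs_mul_mul_sub_le hA hK (b1 _ (hYI q hq)) (hV p hp) (hV q hq) (hinv p hp)
        (hwH p hp q hq) (hVH p hp q hq) (hinvH p hp q hq)).trans (le_of_eq ?_)
      rw [gradHolderConst]
      ring
    have hV₁ : ∀ z ∈ Noz L, |V₁ z| ≤ K := fun z hz => abs_le_of_whNorm_le h.hα hK h.bound₁ hz
    have hV₂ : ∀ z ∈ Noz L, |-V₂ z| ≤ K := fun z hz => by
      rw [abs_neg]
      exact abs_le_of_whNorm_le h.hα hK h.bound₂ hz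
    rw [hAeq, ← ENNReal.ofReal_mul (transportConst_pos hα hK hν).le]
    have hconst : transportConst α K ν * A =
        A + 2 * (A * (K * ν⁻¹)) + 2 * (A * gradHolderConst α K ν) := by
      rw [transportConst]
      ring
    rw [hconst]
    have hgc := gradHolderConst_nonneg hα hK hν
    refine hNorm_one_le hA (by positivity) (by positivity) ?_ ?_ ?_ ?_ ?_
    · intro z hz
      beta_reduce
      rw [hE (hYI z hz)]
      exact b0 _ (hYI z hz)
    · intro z hz
      rw [hpd1 W₀ z hz]
      exact hsup (fun z => -V₂ z) hV₂ z hz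
    · intro z hz
      rw [hpd2 W₀ z hz]
      exact hsup V₁ hV₁ z hz
    · intro p hp q hq
      rw [hpd1 W₀ p hp, hpd1 W₀ q hq]
      refine hhol (fun z => -V₂ z) hV₂ (fun p hp q hq => ?_) p hp q hq
      rw [neg_sub_neg, abs_sub_comm]
      exact abs_sub_le_of_whNorm_le h.hL h.hα hK h.diff₂ h.bound₂ hp hq
    · intro p hp q hq
      rw [hpd2 W₀ p hp, hpd2 W₀ q hq]
      exact hhol V₁ hV₁ (fun p hp q hq =>
        abs_sub_le_of_whNorm_le h.hL h.hα hK h.diff₁ h.bound₁ hp hq) p hp q hq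
  · rintro W' ⟨⟨U', hU', hNU', hW'c⟩, htr, hin⟩
    have hW'cont : ContinuousOn W' (closure (Noz L)) := hW'c.continuousOn.mono hNU'
    refine EqOn.of_subset_closure (s := Noz L) ?_ (hWc.continuousOn.mono hNU) hW'cont
      subset_closure subset_rfl
    intro z hz
    have hdiff : DifferentiableOn ℝ W' (Noz L) :=
      (hW'c.differentiableOn one_ne_zero).mono (subset_closure.trans hNU')
    rw [h.eq_of_stream_eq hW'cont hdiff htr hz (hYs z hz),
      hin _ (Ioo_subset_Icc_self (hYmem z hz))]
    exact hE (Ioo_subset_Icc_self (hYmem z hz))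

/-- Lemma 4.1. Fix `α ∈ (0,1)`, `K₀ > 0` and `ν* > 0`. Suppose a vector
field `V = (V₁,V₂)` on `N̄` satisfies `div V = 0` in `N`, `V·n_w = 0` on `Γ_w`,
`‖V‖^{(−α,Γ̄_w)}_{1,α,N} ≤ K₀`, and `V₁ ≥ ν*` on `N̄`. Then for any
`W_en ∈ C^{1,α}(Γ₀;ℝ²)` and any constant vector `W₀ ∈ ℝ²`, the transport problem
`V·∇W = 0` in `N`, `W = W_en` on `Γ₀` has a unique solution `W ∈ C^{1,α}(N̄;ℝ²)`, and
`‖W − W₀‖_{1,α,N} ≤ C*‖W_en − W₀‖_{1,α,Γ₀}` with `C*` depending only on `L`, `ν*`, `K₀`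
and `α`. -/
theorem stmt9 (L α K₀ νs : ℝ) (hL : 0 < L) (hα : α ∈ Ioo (0:ℝ) 1)
    (hK₀ : 0 < K₀) (hνs : 0 < νs) :
    ∃ C > (0:ℝ), ∀ V₁ V₂ : Pt → ℝ,
      -- regularity of `V`
      ContinuousOn V₁ (closure (Noz L)) → ContinuousOn V₂ (closure (Noz L)) →
      DifferentiableOn ℝ V₁ (Noz L) → DifferentiableOn ℝ V₂ (Noz L) →
      -- `div V = 0` in `N`
      (∀ x ∈ Noz L, pd1 V₁ x + pd2 V₂ x = 0) →
      -- `V·n_w = 0` on `Γ_w`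
      (∀ x ∈ GamW L, V₂ x = 0) →
      -- `‖V‖^{(−α,Γ̄_w)}_{1,α,N} ≤ K₀`
      whNorm 1 α (-α) (GamWbar L) (Noz L) V₁ + whNorm 1 α (-α) (GamWbar L) (Noz L) V₂
        ≤ ENNReal.ofReal K₀ →
      -- `V₁ ≥ ν*` on `N̄`
      (∀ x ∈ closure (Noz L), νs ≤ V₁ x) →
      -- boundary data `W_en = (Wen₁, Wen₂) ∈ C^{1,α}(Γ₀; ℝ²)`
      ∀ Wen₁ Wen₂ : ℝ → ℝ,
        ContDiffOn ℝ 1 Wen₁ (Icc 0 1) → ContDiffOn ℝ 1 Wen₂ (Icc 0 1) →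
        h1Norm 1 α (Icc 0 1) Wen₁ ≠ ⊤ → h1Norm 1 α (Icc 0 1) Wen₂ ≠ ⊤ →
      -- constant vector `W₀ = (W₀₁, W₀₂)`
      ∀ W₀₁ W₀₂ : ℝ,
        ∃ W₁ W₂ : Pt → ℝ,
          TranSol L V₁ V₂ Wen₁ W₁ ∧ TranSol L V₁ V₂ Wen₂ W₂ ∧
          (hNorm 1 α (Noz L) (fun x => W₁ x - W₀₁) + hNorm 1 α (Noz L) (fun x => W₂ x - W₀₂)
            ≤ ENNReal.ofReal C *
              (h1Norm 1 α (Icc 0 1) (fun t => Wen₁ t - W₀₁)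
                + h1Norm 1 α (Icc 0 1) (fun t => Wen₂ t - W₀₂))) ∧
          (∀ W₁' W₂' : Pt → ℝ, TranSol L V₁ V₂ Wen₁ W₁' → TranSol L V₁ V₂ Wen₂ W₂' →
            EqOn W₁ W₁' (closure (Noz L)) ∧ EqOn W₂ W₂' (closure (Noz L))) := by
  refine ⟨transportConst α K₀ νs, transportConst_pos hα.1 hK₀.le hνs, ?_⟩
  intro V₁ V₂ hc₁ hc₂ hd₁ hd₂ hdiv hslip hnorm hlow Wen₁ Wen₂ hW₁ hW₂ _ _ W₀₁ W₀₂
  have h : IsNozzleFlow L α K₀ νs V₁ V₂ :=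
    ⟨hL, hα, hK₀.le, hνs, hc₁, hc₂, hd₁, hd₂, hdiv, hslip, le_self_add.trans hnorm,
      le_add_self.trans hnorm, hlow⟩
  obtain ⟨W₁, hs₁, he₁, hu₁⟩ := h.exists_transport_solution hW₁ W₀₁
  obtain ⟨W₂, hs₂, he₂, hu₂⟩ := h.exists_transport_solution hW₂ W₀₂
  refine ⟨W₁, W₂, hs₁, hs₂, ?_, fun W₁' W₂' h₁ h₂ => ⟨hu₁ W₁' h₁, hu₂ W₂' h₂⟩⟩
  rw [mul_add]
  exact add_le_add he₁ he₂
end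
end

section
/- Suppose V=(V₁,V₂) ∈ C¹(N̄;ℝ²) satisfies div V = 0 in N, V·n_w = 0 on Γ_w, and V₁ ≥ ν* > 0 on N̄. If Ŵ ∈ C¹(N̄) satisfies V·∇Ŵ = 0 in N and Ŵ = 0 on Γ₀, then Ŵ ≡ 0 on N̄. -/
open Real Set Metric MeasureTheory
open scoped ENNReal

noncomputable section

/-- A smooth field with zero divergence in the rectangle `(0,a) × (0,1)` and vanishing vertical
component on the horizontal sides has the same flux through both vertical sides. -/
theorem flux_eq_of_div_eq_zero {a : ℝ} (ha : 0 ≤ a) {f g : Pt → ℝ}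
    (hf : ContinuousOn f (Icc 0 a ×ˢ Icc 0 1)) (hg : ContinuousOn g (Icc 0 a ×ˢ Icc 0 1))
    (hf' : ∀ x ∈ Noz a, DifferentiableAt ℝ f x) (hg' : ∀ x ∈ Noz a, DifferentiableAt ℝ g x)
    (hdiv : ∀ x ∈ Noz a, pd1 f x + pd2 g x = 0) (hwall : ∀ x ∈ GamW a, g x = 0) :
    ∫ y in (0:ℝ)..1, f (a, y) = ∫ y in (0:ℝ)..1, f (0, y) := by
  classical
  -- Extending the derivatives by zero makes the divergence vanish identically.
  have hzero : ∀ x : Pt, (if x ∈ Noz a then fderiv ℝ f x else 0) (1, 0) +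
      (if x ∈ Noz a then fderiv ℝ g x else 0) (0, 1) = 0 := by
    intro x
    split_ifs with hx
    · exact hdiv x hx
    · simp
  have key := integral2_divergence_prod_of_hasFDerivAt f g
    (fun x => if x ∈ Noz a then fderiv ℝ f x else 0)
    (fun x => if x ∈ Noz a then fderiv ℝ g x else 0) 0 0 a 1
    (by rwa [uIcc_of_le ha, uIcc_of_le zero_le_one])
    (by rwa [uIcc_of_le ha, uIcc_of_le zero_le_one])
    (by
      rw [min_eq_left ha, max_eq_right ha, min_eq_left zero_le_one, max_eq_right zero_le_one]
      intro x (hx : x ∈ Noz a)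
      rw [if_pos hx]
      exact (hf' x hx).hasFDerivAt)
    (by
      rw [min_eq_left ha, max_eq_right ha, min_eq_left zero_le_one, max_eq_right zero_le_one]
      intro x (hx : x ∈ Noz a)
      rw [if_pos hx]
      exact (hg' x hx).hasFDerivAt)
    (by
      simp only [hzero]
      exact integrableOn_zero)
  have hside : ∀ c ∈ ({0, 1} : Set ℝ), ∫ x in (0:ℝ)..a, g (x, c) = 0 := by
    intro c hc
    rw [intervalIntegral.integral_congr_Ioo_of_le (g := fun _ => 0) ha
      fun x hx => hwall (x, c) ⟨hx, hc⟩]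
    simp
  simp only [hzero, hside 0 (by simp), hside 1 (by simp), intervalIntegral.integral_zero] at key
  linarith

/-- If `V` has zero divergence and `W` is transported by `V`, then `W ^ 2 V` has zero
divergence. -/
theorem div_mul_sq_eq_zero {V₁ V₂ W : Pt → ℝ} {x : Pt} (hV₁ : DifferentiableAt ℝ V₁ x)
    (hV₂ : DifferentiableAt ℝ V₂ x) (hW : DifferentiableAt ℝ W x)
    (hdiv : pd1 V₁ x + pd2 V₂ x = 0) (htrans : V₁ x * pd1 W x + V₂ x * pd2 W x = 0) :
    pd1 (fun x => V₁ x * W x ^ 2) x + pd2 (fun x => V₂ x * W x ^ 2) x = 0 := by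
  unfold pd1 pd2 at *
  rw [(hV₁.hasFDerivAt.fun_mul (hW.hasFDerivAt.pow 2)).fderiv,
    (hV₂.hasFDerivAt.fun_mul (hW.hasFDerivAt.pow 2)).fderiv]
  simp
  linear_combination W x ^ 2 * hdiv + 2 * W x * htrans

theorem UpTo.continuousOn {f : Pt → ℝ} {K : Set Pt} (h : UpTo 1 f K) : ContinuousOn f K := by
  obtain ⟨U, -, hKU, hf⟩ := h
  exact hf.continuousOn.mono hKU

theorem UpTo.differentiableAt {f : Pt → ℝ} {K : Set Pt} (h : UpTo 1 f K) {x : Pt}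
    (hx : x ∈ K) : DifferentiableAt ℝ f x := by
  obtain ⟨U, hU, hKU, hf⟩ := h
  exact (hf.differentiableOn (by simp)).differentiableAt (hU.mem_nhds (hKU hx))

/-- Suppose `V = (V₁,V₂) ∈ C¹(N̄;ℝ²)` satisfies `div V = 0` in `N`,
`V·n_w = 0` on `Γ_w`, and `V₁ ≥ ν* > 0` on `N̄`. If `Ŵ ∈ C¹(N̄)` satisfies `V·∇Ŵ = 0`
in `N` and `Ŵ = 0` on `Γ₀`, then `Ŵ ≡ 0` on `N̄`. -/
theorem stmt13 (L νs : ℝ) (hL : 0 < L) (hνs : 0 < νs) (V₁ V₂ : Pt → ℝ) (W : Pt → ℝ)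
    (hV₁ : UpTo 1 V₁ (closure (Noz L))) (hV₂ : UpTo 1 V₂ (closure (Noz L)))
    (hdiv : ∀ x ∈ Noz L, pd1 V₁ x + pd2 V₂ x = 0)
    (hwall : ∀ x ∈ GamW L, V₂ x = 0)
    (hpos : ∀ x ∈ closure (Noz L), νs ≤ V₁ x)
    (hW : UpTo 1 W (closure (Noz L)))
    (htrans : ∀ x ∈ Noz L, V₁ x * pd1 W x + V₂ x * pd2 W x = 0)
    (hent : ∀ t ∈ Icc (0:ℝ) 1, W (0, t) = 0) :
    ∀ x ∈ closure (Noz L), W x = 0 := by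
  rw [closure_Noz hL] at *
  rintro ⟨a, t⟩ ⟨ha, ht⟩
  dsimp only at ha ht
  have hsub : Icc 0 a ×ˢ Icc 0 1 ⊆ Icc 0 L ×ˢ Icc (0:ℝ) 1 :=
    prod_mono (Icc_subset_Icc_right ha.2) subset_rfl
  have hNoz : Noz a ⊆ Noz L := prod_mono (Ioo_subset_Ioo_right ha.2) subset_rfl
  have hNozIcc : Noz a ⊆ Icc 0 L ×ˢ Icc 0 1 :=
    (prod_mono Ioo_subset_Icc_self Ioo_subset_Icc_self).trans hsub
  have hcont : ContinuousOn (fun x => V₁ x * W x ^ 2) (Icc 0 L ×ˢ Icc 0 1) :=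
    hV₁.continuousOn.mul (hW.continuousOn.pow 2)
  have hflux := flux_eq_of_div_eq_zero ha.1
    (hcont.mono hsub) ((hV₂.continuousOn.mul (hW.continuousOn.pow 2)).mono hsub)
    (fun x hx => (hV₁.differentiableAt (hNozIcc hx)).mul
      ((hW.differentiableAt (hNozIcc hx)).pow 2))
    (fun x hx => (hV₂.differentiableAt (hNozIcc hx)).mul
      ((hW.differentiableAt (hNozIcc hx)).pow 2))
    (fun x hx => div_mul_sq_eq_zero (hV₁.differentiableAt (hNozIcc hx))
      (hV₂.differentiableAt (hNozIcc hx)) (hW.differentiableAt (hNozIcc hx))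
      (hdiv x (hNoz hx)) (htrans x (hNoz hx)))
    (fun x hx => by
      simp [hwall x (prod_mono (Ioo_subset_Ioo_right ha.2) subset_rfl hx)])
  have hinflow : ∫ y in (0:ℝ)..1, V₁ (0, y) * W (0, y) ^ 2 = 0 := by
    rw [intervalIntegral.integral_congr_Ioo_of_le (g := fun _ => 0) zero_le_one
      fun y hy => by simp [hent y (Ioo_subset_Icc_self hy)]]
    simp
  have hV₁pos : ∀ y ∈ Icc (0:ℝ) 1, 0 < V₁ (a, y) :=
    fun y hy => hνs.trans_le (hpos (a, y) ⟨ha, hy⟩)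
  by_contra hne
  have hlt : 0 < ∫ y in (0:ℝ)..1, V₁ (a, y) * W (a, y) ^ 2 := by
    refine intervalIntegral.integral_pos zero_lt_one
      (hcont.comp (by fun_prop) fun y hy => ⟨ha, hy⟩)
      (fun y hy => mul_nonneg (hV₁pos y (Ioc_subset_Icc_self hy)).le (sq_nonneg _))
      ⟨t, ht, mul_pos (hV₁pos t ht) (by positivity)⟩
  exact hlt.ne' (hflux.trans hinflow)
end
end

section
/- Let Ω ⊂ ℝ² be open, let ρ,u,v,p ∈ C¹(Ω), Φ ∈ C²(Ω), b ∈ C(Ω), with ρ > 0 and u > 0 in Ω. Then (ρ,u,v,p,Φ) solves the steady Euler–Poisson system — (ρu)_{x₁}+(ρv)_{x₂}=0, (ρu²+p)_{x₁}+(ρuv)_{x₂}=ρΦ_{x₁}, (ρuv)_{x₁}+(ρv²+p)_{x₂}=ρΦ_{x₂}, (ρuB)_{x₁}+(ρvB)_{x₂}=ρ(uΦ_{x₁}+vΦ_{x₂}), ΔΦ=ρ−b — if and only if it satisfies the system: (ρu)_{x₁}+(ρv)_{x₂}=0, (ρuv)_{x₁}+(ρv²+p)_{x₂}=ρΦ_{x₂},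 ρ(uS_{x₁}+vS_{x₂})=0, ρ(uK_{x₁}+vK_{x₂})=0, ΔΦ=ρ−b, where S = c_v ln(p/(𝔭ρ^γ)), B = (u²+v²)/2 + γp/((γ−1)ρ), and K = B − Φ. -/
open Real Set Metric MeasureTheory
open scoped ENNReal

noncomputable section

/-- Directional derivative of the Bernoulli function. -/
lemma fderiv_BernFn_apply {γ : ℝ} (hγ : 1 < γ) {ρ u v p : Pt → ℝ} {x : Pt}
    (hρ : DifferentiableAt ℝ ρ x) (hu : DifferentiableAt ℝ u x)
    (hv : DifferentiableAt ℝ v x) (hp : DifferentiableAt ℝ p x) (hρx : 0 < ρ x) :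
    DifferentiableAt ℝ (BernFn γ ρ u v p) x ∧ ∀ e : Pt, fderiv ℝ (BernFn γ ρ u v p) x e =
      u x * fderiv ℝ u x e + v x * fderiv ℝ v x e
        + γ / (γ - 1) * (fderiv ℝ p x e / ρ x - p x * fderiv ℝ ρ x e / ρ x ^ 2) := by
  have hγ' : γ - 1 ≠ 0 := by linarith
  have hB := (((hu.hasFDerivAt.pow 2).add (hv.hasFDerivAt.pow 2)).mul_const (1 / 2)).add
    ((hp.hasFDerivAt.mul ((hasDerivAt_inv hρx.ne').comp_hasFDerivAt x hρ.hasFDerivAt)).const_mul (γ / (γ - 1)))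
  have hB' := hB.congr_of_eventuallyEq (f₁ := BernFn γ ρ u v p) <| .of_forall fun y => by
    simp [BernFn, div_eq_mul_inv]
    ring
  refine ⟨hB'.differentiableAt, fun e => ?_⟩
  rw [hB'.fderiv]
  simp
  field_simp
  ring

/-- Directional derivative of the entropy `S = c_v ln (p / (𝔭 ρ^γ))`. -/
lemma fderiv_entropy_apply {𝔭 : ℝ} (γ cv : ℝ) (h𝔭 : 0 < 𝔭) {ρ p : Pt → ℝ} {x : Pt}
    (hρ : DifferentiableAt ℝ ρ x) (hp : DifferentiableAt ℝ p x) (hρx : 0 < ρ x)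
    (hpx : 0 < p x) (e : Pt) :
    fderiv ℝ (fun y => cv * Real.log (p y / (𝔭 * ρ y ^ γ))) x e =
      cv * (fderiv ℝ p x e / p x - γ * fderiv ℝ ρ x e / ρ x) := by
  have hS := (((hp.hasFDerivAt.log hpx.ne').sub
    ((hρ.hasFDerivAt.log hρx.ne').const_mul γ)).sub_const (Real.log 𝔭)).const_mul cv
  have hS' := hS.congr_of_eventuallyEq
      (f₁ := fun y => cv * Real.log (p y / (𝔭 * ρ y ^ γ))) <| by
    filter_upwards [hρ.continuousAt.eventually (lt_mem_nhds hρx),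
      hp.continuousAt.eventually (lt_mem_nhds hpx)] with y hρy hpy
    have hργ := Real.rpow_pos_of_pos hρy γ
    rw [Real.log_div hpy.ne' (by positivity), Real.log_mul h𝔭.ne' hργ.ne',
      Real.log_rpow hρy]
    simp only [Pi.sub_apply]
    ring
  rw [hS'.fderiv]
  simp only [smul_apply, sub_apply, smul_eq_mul]
  ring

/-- Directional derivative of a product of two functions. -/
lemma fderiv_mul_fun_apply {f g : Pt → ℝ} {x : Pt} (hf : DifferentiableAt ℝ f x)
    (hg : DifferentiableAt ℝ g x) (e : Pt) :
    fderiv ℝ (fun y => f y * g y) x e = f x * fderiv ℝ g x e + g x * fderiv ℝ f x e := by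
  simp [fderiv_fun_mul hf hg]

/-- Directional derivative of a momentum flux `ρ w² + p`. -/
lemma fderiv_mul_sq_add_apply {ρ w p : Pt → ℝ} {x : Pt} (hρ : DifferentiableAt ℝ ρ x)
    (hw : DifferentiableAt ℝ w x) (hp : DifferentiableAt ℝ p x) (e : Pt) :
    fderiv ℝ (fun y => ρ y * w y ^ 2 + p y) x e =
      w x ^ 2 * fderiv ℝ ρ x e + 2 * ρ x * w x * fderiv ℝ w x e + fderiv ℝ p x e := by
  rw [((hρ.hasFDerivAt.fun_mul (hw.hasFDerivAt.pow 2)).fun_add hp.hasFDerivAt).fderiv]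
  simp
  ring

/-- Let `Ω ⊆ ℝ²` be open, `ρ,u,v,p ∈ C¹(Ω)`, `Φ ∈ C²(Ω)`,
`b ∈ C(Ω)`, with `ρ > 0`, `u > 0` (and `p > 0`) in `Ω`. Then `(ρ,u,v,p,Φ)` solves the
steady Euler–Poisson system if and only if it satisfies the system consisting of the
continuity equation, the `x₂`-momentum equation, the transport equations
`ρ(uS_{x₁}+vS_{x₂}) = 0` and `ρ(uK_{x₁}+vK_{x₂}) = 0`, and the Poisson equation, where
`S = c_v ln(p/(𝔭ρ^γ))`, `B = (u²+v²)/2 + γp/((γ−1)ρ)` and `K = B − Φ`. -/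
theorem stmt15 (γ 𝔭 cv : ℝ) (hγ : 1 < γ) (h𝔭 : 0 < 𝔭) (hcv : 0 < cv)
    (Ω : Set Pt) (hΩ : IsOpen Ω) (ρ u v p Φ b : Pt → ℝ)
    (hρ : ContDiffOn ℝ 1 ρ Ω) (hu : ContDiffOn ℝ 1 u Ω) (hv : ContDiffOn ℝ 1 v Ω)
    (hp : ContDiffOn ℝ 1 p Ω) (hΦ : ContDiffOn ℝ 2 Φ Ω) (hb : ContinuousOn b Ω)
    (hρpos : ∀ x ∈ Ω, 0 < ρ x) (hupos : ∀ x ∈ Ω, 0 < u x) (hppos : ∀ x ∈ Ω, 0 < p x) :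
    -- the steady Euler–Poisson system
    (∀ x ∈ Ω,
      pd1 (fun y => ρ y * u y) x + pd2 (fun y => ρ y * v y) x = 0 ∧
      pd1 (fun y => ρ y * u y ^ 2 + p y) x + pd2 (fun y => ρ y * u y * v y) x
        = ρ x * pd1 Φ x ∧
      pd1 (fun y => ρ y * u y * v y) x + pd2 (fun y => ρ y * v y ^ 2 + p y) x
        = ρ x * pd2 Φ x ∧
      pd1 (fun y => ρ y * u y * BernFn γ ρ u v p y) x
        + pd2 (fun y => ρ y * v y * BernFn γ ρ u v p y) x
        = ρ x * (u x * pd1 Φ x + v x * pd2 Φ x) ∧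
      lap Φ x = ρ x - b x)
    ↔
    -- the reformulated system with transport of `S` and `K = B − Φ`
    (∀ x ∈ Ω,
      pd1 (fun y => ρ y * u y) x + pd2 (fun y => ρ y * v y) x = 0 ∧
      pd1 (fun y => ρ y * u y * v y) x + pd2 (fun y => ρ y * v y ^ 2 + p y) x
        = ρ x * pd2 Φ x ∧
      ρ x * (u x * pd1 (fun y => cv * Real.log (p y / (𝔭 * ρ y ^ γ))) x
          + v x * pd2 (fun y => cv * Real.log (p y / (𝔭 * ρ y ^ γ))) x) = 0 ∧
      ρ x * (u x * pd1 (fun y => BernFn γ ρ u v p y - Φ y) x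
          + v x * pd2 (fun y => BernFn γ ρ u v p y - Φ y) x) = 0 ∧
      lap Φ x = ρ x - b x) := by
  refine forall₂_congr fun x hx => ?_
  have hN := hΩ.mem_nhds hx
  have dρ := (hρ.contDiffAt hN).differentiableAt one_ne_zero
  have du := (hu.contDiffAt hN).differentiableAt one_ne_zero
  have dv := (hv.contDiffAt hN).differentiableAt one_ne_zero
  have dp := (hp.contDiffAt hN).differentiableAt one_ne_zero
  have dΦ := (hΦ.contDiffAt hN).differentiableAt two_ne_zero
  have hρx := hρpos x hx
  have hux := hupos x hx
  have hpx := hppos x hx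
  have hγ' : 0 < γ - 1 := by linarith
  obtain ⟨dB, hB⟩ := fderiv_BernFn_apply hγ dρ du dv dp hρx
  have hK : ∀ e : Pt, fderiv ℝ (fun y => BernFn γ ρ u v p y - Φ y) x e
      = fderiv ℝ (BernFn γ ρ u v p) x e - fderiv ℝ Φ x e := fun e => by
    simp [fderiv_fun_sub dB dΦ]
  simp only [pd1, pd2, fderiv_mul_fun_apply dρ du, fderiv_mul_fun_apply dρ dv,
    fderiv_mul_fun_apply (dρ.fun_mul du) dv, fderiv_mul_fun_apply (dρ.fun_mul du) dB,
    fderiv_mul_fun_apply (dρ.fun_mul dv) dB, fderiv_mul_sq_add_apply dρ du dp,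
    fderiv_mul_sq_add_apply dρ dv dp, fderiv_entropy_apply γ cv h𝔭 dρ dp hρx hpx, hK]
  have hB1 := hB (1, 0)
  have hB2 := hB (0, 1)
  generalize fderiv ℝ (BernFn γ ρ u v p) x (1, 0) = B1 at *
  generalize fderiv ℝ (BernFn γ ρ u v p) x (0, 1) = B2 at *
  generalize BernFn γ ρ u v p x = B at *
  generalize fderiv ℝ ρ x (1, 0) = ρ1 at *
  generalize fderiv ℝ ρ x (0, 1) = ρ2 at *
  generalize fderiv ℝ u x (1, 0) = u1 at *
  generalize fderiv ℝ u x (0, 1) = u2 at *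
  generalize fderiv ℝ v x (1, 0) = v1 at *
  generalize fderiv ℝ v x (0, 1) = v2 at *
  generalize fderiv ℝ p x (1, 0) = p1 at *
  generalize fderiv ℝ p x (0, 1) = p2 at *
  generalize fderiv ℝ Φ x (1, 0) = Φ1 at *
  generalize fderiv ℝ Φ x (0, 1) = Φ2 at *
  -- `ρ DK` is a combination of the two momentum residuals and `DS`, where `D = u ∂₁ + v ∂₂`.
  have key : ρ x * (u x * (B1 - Φ1) + v x * (B2 - Φ2)) =
      u x * (ρ x * (u x * u1 + v x * u2) + p1 - ρ x * Φ1)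
      + v x * (ρ x * (u x * v1 + v x * v2) + p2 - ρ x * Φ2)
      + p x / (γ - 1) * (u x * (p1 / p x - γ * ρ1 / ρ x)
        + v x * (p2 / p x - γ * ρ2 / ρ x)) := by
    rw [hB1, hB2]
    field_simp
    ring
  constructor
  · rintro ⟨hC, hM1, hM2, hE, hP⟩
    have m1 : ρ x * (u x * u1 + v x * u2) + p1 - ρ x * Φ1 = 0 := by
      linear_combination hM1 - u x * hC
    have m2 : ρ x * (u x * v1 + v x * v2) + p2 - ρ x * Φ2 = 0 := by
      linear_combination hM2 - v x * hC
    have k : ρ x * (u x * (B1 - Φ1) + v x * (B2 - Φ2)) = 0 := by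
      linear_combination hE - B * hC
    rw [k, m1, m2, mul_zero, mul_zero, zero_add, zero_add, eq_comm] at key
    have s := (mul_eq_zero.mp key).resolve_left (by positivity)
    exact ⟨hC, hM2, by linear_combination ρ x * cv * s, k, hP⟩
  · rintro ⟨hC, hM2, hS, k, hP⟩
    have m2 : ρ x * (u x * v1 + v x * v2) + p2 - ρ x * Φ2 = 0 := by
      linear_combination hM2 - v x * hC
    have s : u x * (p1 / p x - γ * ρ1 / ρ x) + v x * (p2 / p x - γ * ρ2 / ρ x) = 0 := by
      refine mul_left_cancel₀ (mul_pos hρx hcv).ne' ?_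
      linear_combination hS
    rw [k, m2, s, mul_zero, mul_zero, add_zero, add_zero, eq_comm] at key
    have m1 := (mul_eq_zero.mp key).resolve_left hux.ne'
    exact ⟨hC, by linear_combination m1 + u x * hC, hM2,
      by linear_combination k + B * hC, hP⟩
end
end
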